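/- arXiv:math/0607112 — 9 statements merged into one kernel-verified Lean document; each statement's English description precedes it below -/
import Mathlib

section
/- Let y, z ∈ ℂ with E(e^{2Re(y)X₁}) < ∞ and E(e^{2Re(z)X₁}) < ∞, and let ΔL(z)_n = S_{n−1}^z h(z)^{N−n} (e^{zΔX_n} − h(z) − g(z)(e^{ΔX_n} − 1)). Then for each n = 1, …, N one has E(ΔL(y)_n ΔL(z)_n) = S₀^{y+z} (h(y)h(z))^{N−n} m(y+z)^{n−1} b(y,z), where b(y,z) = m(y+z) − (m(2)m(y)m(z) − m(1)m(y+1)m(z) − m(1)m(y)m(z+1) + m(y+1)m(z+1))/(m(2) − m(1)²). -/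
open MeasureTheory ProbabilityTheory Finset

/-- Expectation of a product of two affine residuals with a common square-integrable regressor. -/
theorem integral_mul_sub_const_sub_mul {Ω : Type*} {m0 : MeasurableSpace Ω} {P : Measure Ω}
    [IsProbabilityMeasure P] {A B E : Ω → ℂ} (hA : MemLp A 2 P) (hB : MemLp B 2 P)
    (hE : MemLp E 2 P) (c d a e : ℂ) :
    ∫ ω, (A ω - c - a * E ω) * (B ω - d - e * E ω) ∂P
      = ∫ ω, A ω * B ω ∂P - d * ∫ ω, A ω ∂P - e * ∫ ω, A ω * E ω ∂P
        - c * ∫ ω, B ω ∂P + c * d + c * e * ∫ ω, E ω ∂P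
        - a * ∫ ω, B ω * E ω ∂P + a * d * ∫ ω, E ω ∂P + a * e * ∫ ω, E ω * E ω ∂P := by
  have iA := hA.integrable one_le_two
  have iB := hB.integrable one_le_two
  have iE := hE.integrable one_le_two
  have iAB : Integrable (fun ω => A ω * B ω) P := hA.integrable_mul hB
  have iAE : Integrable (fun ω => A ω * E ω) P := hA.integrable_mul hE
  have iBE : Integrable (fun ω => B ω * E ω) P := hB.integrable_mul hE
  have iEE : Integrable (fun ω => E ω * E ω) P := hE.integrable_mul hE
  have expand : ∀ ω, (A ω - c - a * E ω) * (B ω - d - e * E ω)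
      = A ω * B ω - d * A ω - e * (A ω * E ω) - c * B ω + c * d + c * e * E ω
        - a * (B ω * E ω) + a * d * E ω + a * e * (E ω * E ω) := fun ω => by ring
  simp_rw [expand]
  rw [integral_add (by fun_prop) (by fun_prop), integral_add (by fun_prop) (by fun_prop),
    integral_sub (by fun_prop) (by fun_prop), integral_add (by fun_prop) (by fun_prop),
    integral_add (by fun_prop) (by fun_prop), integral_sub (by fun_prop) (by fun_prop),
    integral_sub (by fun_prop) (by fun_prop), integral_sub (by fun_prop) (by fun_prop)]
  simp only [integral_const_mul, integral_const, probReal_univ, one_smul]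

/-- `exp (w Y)` is square integrable as soon as `exp (2 Re(w) Y)` is integrable. -/
theorem memLp_two_cexp_mul {Ω : Type*} {m0 : MeasurableSpace Ω} {P : Measure Ω}
    {Y : Ω → ℝ} (hY : Measurable Y) {w : ℂ}
    (hw : Integrable (fun ω => Real.exp (2 * w.re * Y ω)) P) :
    MemLp (fun ω => Complex.exp (w * (Y ω : ℂ))) 2 P := by
  rw [memLp_two_iff_integrable_sq_norm (by fun_prop)]
  refine hw.congr (.of_forall fun ω => ?_)
  simp [Complex.norm_exp, ← Real.exp_nat_mul, mul_assoc]

/-- The second moment of a non-degenerate `exp Y` differs from its squared mean. -/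
theorem integral_cexp_two_sub_sq_ne_zero {Ω : Type*} {m0 : MeasurableSpace Ω} {P : Measure Ω}
    [IsProbabilityMeasure P] {Y : Ω → ℝ} (hY : Measurable Y)
    (hint : Integrable (fun ω => Real.exp (2 * Y ω)) P)
    (hndeg : ¬ ∃ c : ℝ, (fun ω => Real.exp (Y ω)) =ᵐ[P] fun _ => c) :
    ∫ ω, Complex.exp (2 * (Y ω : ℂ)) ∂P - (∫ ω, Complex.exp (1 * (Y ω : ℂ)) ∂P) ^ 2 ≠ 0 := by
  have sq : ∀ ω, Real.exp (Y ω) ^ 2 = Real.exp (2 * Y ω) := fun ω => by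
    simp [← Real.exp_nat_mul]
  have hL : MemLp (fun ω => Real.exp (Y ω)) 2 P := by
    rw [memLp_two_iff_integrable_sq (by fun_prop)]
    simpa only [sq] using hint
  have hvar : Var[fun ω => Real.exp (Y ω); P] ≠ 0 := fun h0 => by
    have h0' := hL.ofReal_variance_eq
    rw [h0, ENNReal.ofReal_zero] at h0'
    exact hndeg ⟨_, (evariance_eq_zero_iff hL.aemeasurable).1 h0'.symm⟩
  rw [variance_eq_sub hL] at hvar
  have cast2 : ∫ ω, Complex.exp (2 * (Y ω : ℂ)) ∂P = ((∫ ω, Real.exp (2 * Y ω) ∂P : ℝ) : ℂ) := by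
    rw [← integral_complex_ofReal]; simp
  have cast1 : ∫ ω, Complex.exp (1 * (Y ω : ℂ)) ∂P = ((∫ ω, Real.exp (Y ω) ∂P : ℝ) : ℂ) := by
    rw [← integral_complex_ofReal]; simp
  rw [cast1, cast2]
  simp only [Pi.pow_apply, sq] at hvar
  exact_mod_cast hvar

/-- For independent stationary increments the exponential moment at time `k` is a `k`-th power. -/
theorem integral_cexp_mul_eq_pow {Ω : Type*} {m0 : MeasurableSpace Ω} {P : Measure Ω}
    [IsProbabilityMeasure P] {N : ℕ} {X : ℕ → Ω → ℝ} (hX : ∀ n ≤ N, Measurable (X n))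
    (hX0 : ∀ ω, X 0 ω = 0)
    (hindep : ∀ n < N, IndepFun (X n) (fun ω => X (n + 1) ω - X n ω) P)
    (hstat : ∀ n < N, IdentDistrib (fun ω => X (n + 1) ω - X n ω) (X 1) P P) (w : ℂ) :
    ∀ k ≤ N, ∫ ω, Complex.exp (w * (X k ω : ℂ)) ∂P
      = (∫ ω, Complex.exp (w * (X 1 ω : ℂ)) ∂P) ^ k := by
  intro k
  induction k with
  | zero => intro _; simp [hX0]
  | succ k ih =>
    intro hk
    have hm : Measurable fun x : ℝ => Complex.exp (w * (x : ℂ)) := by fun_prop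
    have hsplit : ∀ ω, Complex.exp (w * (X (k + 1) ω : ℂ))
        = Complex.exp (w * (X k ω : ℂ)) * Complex.exp (w * ((X (k + 1) ω - X k ω : ℝ) : ℂ)) :=
      fun ω => by rw [← Complex.exp_add]; congr 1; push_cast; ring
    have hinc := ((hstat k hk).comp hm).integral_eq
    simp only [Function.comp_def] at hinc
    simp_rw [hsplit]
    rw [(hindep k hk).integral_fun_comp_mul_comp (hX k (by lia)).aemeasurable
      ((hX (k + 1) hk).sub (hX k (by lia))).aemeasurable hm.aestronglyMeasurable
      hm.aestronglyMeasurable, ih (by lia), hinc, pow_succ]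

/-- the covariance-type formula
`E(ΔL(y)_n ΔL(z)_n) = S₀^{y+z} (h(y)h(z))^{N-n} m(y+z)^{n-1} b(y,z)`. -/
theorem expectation_delta_L_product
    {Ω : Type*} {m0 : MeasurableSpace Ω} {P : Measure Ω} [IsProbabilityMeasure P]
    (ℱ : Filtration ℕ m0) (N : ℕ) (hN : 1 ≤ N)
    (X : ℕ → Ω → ℝ)
    (hadapt : ∀ n, n ≤ N → StronglyMeasurable[ℱ n] (X n))
    (hX0 : ∀ ω, X 0 ω = 0)
    (hindep : ∀ n, 1 ≤ n → n ≤ N →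
      Indep (MeasurableSpace.comap (fun ω => X n ω - X (n - 1) ω) inferInstance) (ℱ (n - 1)) P)
    (hstat : ∀ n, 1 ≤ n → n ≤ N →
      P.map (fun ω => X n ω - X (n - 1) ω) = P.map (X 1))
    (S₀ : ℝ) (hS₀ : 0 < S₀)
    (S : ℕ → Ω → ℝ) (hS : ∀ n ω, S n ω = S₀ * Real.exp (X n ω))
    (hint2 : Integrable (fun ω => Real.exp (2 * X 1 ω)) P)
    (hndeg : ¬ ∃ c : ℝ, (fun ω => Real.exp (X 1 ω)) =ᵐ[P] fun _ => c)
    (mc : ℂ → ℂ) (hmc : ∀ w : ℂ, mc w = ∫ ω, Complex.exp (w * (X 1 ω : ℂ)) ∂P)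
    (g h : ℂ → ℂ)
    (hg : ∀ w, g w = (mc (w + 1) - mc 1 * mc w) / (mc 2 - mc 1 ^ 2))
    (hh : ∀ w, h w = mc w - (mc 1 - 1) * g w)
    (y z : ℂ)
    (hy : Integrable (fun ω => Real.exp (2 * y.re * X 1 ω)) P)
    (hz : Integrable (fun ω => Real.exp (2 * z.re * X 1 ω)) P)
    (ΔL : ℂ → ℕ → Ω → ℂ)
    (hΔL : ∀ (w : ℂ) (n : ℕ) (ω : Ω), ΔL w n ω
      = ((S₀ : ℂ) ^ w * Complex.exp (w * (X (n - 1) ω : ℂ))) * h w ^ (N - n)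
          * (Complex.exp (w * ((X n ω - X (n - 1) ω : ℝ) : ℂ)) - h w
              - g w * (Complex.exp ((X n ω - X (n - 1) ω : ℝ) : ℂ) - 1)))
    (b : ℂ → ℂ → ℂ)
    (hb : ∀ y z, b y z
      = mc (y + z)
        - (mc 2 * mc y * mc z - mc 1 * mc (y + 1) * mc z - mc 1 * mc y * mc (z + 1)
            + mc (y + 1) * mc (z + 1)) / (mc 2 - mc 1 ^ 2)) :
    ∀ n, 1 ≤ n → n ≤ N →
      ∫ ω, ΔL y n ω * ΔL z n ω ∂P
        = (S₀ : ℂ) ^ (y + z) * (h y * h z) ^ (N - n) * mc (y + z) ^ (n - 1) * b y z := by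
  intro n hn hnN
  obtain ⟨k, rfl⟩ : ∃ k, n = k + 1 := ⟨n - 1, by lia⟩
  have hX : ∀ n ≤ N, Measurable (X n) := fun n hn => ((hadapt n hn).mono (ℱ.le n)).measurable
  have hind : ∀ n < N, IndepFun (X n) (fun ω => X (n + 1) ω - X n ω) P := fun n hn =>
    (indep_of_indep_of_le_right (hindep (n + 1) (by lia) hn)
      (hadapt n hn.le).measurable.comap_le).symm
  have hid : ∀ n < N, IdentDistrib (fun ω => X (n + 1) ω - X n ω) (X 1) P P := fun n hn =>
    ⟨((hX (n + 1) hn).sub (hX n hn.le)).aemeasurable, (hX 1 hN).aemeasurable,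
      hstat (n + 1) (by lia) hn⟩
  have hpow := integral_cexp_mul_eq_pow hX hX0 hind hid (y + z) k (by lia)
  set F : ℝ → ℂ := fun x =>
    (Complex.exp (y * (x : ℂ)) - (h y - g y) - g y * Complex.exp (1 * (x : ℂ)))
      * (Complex.exp (z * (x : ℂ)) - (h z - g z) - g z * Complex.exp (1 * (x : ℂ))) with hF
  have hFm : Measurable F := by fun_prop
  have hEm : Measurable fun x : ℝ => Complex.exp ((y + z) * (x : ℂ)) := by fun_prop
  have hFint : ∫ ω, F (X 1 ω) ∂P = b y z := by
    have hX1 := hX 1 hN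
    have hD : mc 2 - mc 1 ^ 2 ≠ 0 := by
      simpa only [hmc] using integral_cexp_two_sub_sq_ne_zero hX1 hint2 hndeg
    have hE : MemLp (fun ω => Complex.exp (1 * (X 1 ω : ℂ))) 2 P :=
      memLp_two_cexp_mul hX1 (by simpa using hint2)
    have hmul : ∀ u v : ℂ, ∫ ω, Complex.exp (u * (X 1 ω : ℂ)) * Complex.exp (v * (X 1 ω : ℂ)) ∂P
        = mc (u + v) := fun u v => by simp_rw [hmc, add_mul, Complex.exp_add]
    simp only [hF]
    rw [integral_mul_sub_const_sub_mul (memLp_two_cexp_mul hX1 hy) (memLp_two_cexp_mul hX1 hz) hE]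
    simp only [hmul, ← hmc, one_add_one_eq_two]
    rw [hb, hh, hh, hg, hg]
    field_simp
    ring
  have hsplit : ∀ ω, ΔL y (k + 1) ω * ΔL z (k + 1) ω
      = (S₀ : ℂ) ^ (y + z) * (h y * h z) ^ (N - (k + 1))
        * (Complex.exp ((y + z) * (X k ω : ℂ)) * F (X (k + 1) ω - X k ω)) := fun ω => by
    rw [hΔL, hΔL, Complex.cpow_add _ _ (by exact_mod_cast hS₀.ne'), add_mul, Complex.exp_add]
    simp only [hF, Nat.add_sub_cancel, one_mul]
    ring
  have hinc := ((hid k hnN).comp hFm).integral_eq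
  simp only [Function.comp_def] at hinc
  simp_rw [hsplit]
  rw [integral_const_mul, (hind k hnN).integral_fun_comp_mul_comp (hX k (by lia)).aemeasurable
    (hid k hnN).aemeasurable_fst hEm.aestronglyMeasurable hFm.aestronglyMeasurable,
    hinc, hFint, hpow, ← hmc, Nat.add_sub_cancel]
  ring
end

section
/- Let K > 0, R > 1 and s > 0. Then the function v ↦ s^{R+iv} K^{1−R−iv} / ((R+iv)(R+iv−1)) is Lebesgue integrable on ℝ and max(s − K, 0) = (1/2π) ∫_{−∞}^{∞} s^{R+iv} K^{1−R−iv} / ((R+iv)(R+iv−1)) dv, i.e. (s − K)^+ = (1/2πi) ∫_{R−i∞}^{R+i∞} s^z K^{1−z}/(z(z−1)) dz. -/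
open MeasureTheory Complex

/-- The normalized call payoff `t ↦ (1/t - 1)⁺`, as a combination of truncated powers on `(0, 1]`. -/
noncomputable def truncatedPayoff (t : ℝ) : ℂ :=
  (Set.Ioc 0 1).indicator (fun t : ℝ => (t : ℂ) ^ (-1 : ℂ)) t
    - (Set.Ioc 0 1).indicator (fun _ => (1 : ℂ)) t

lemma truncatedPayoff_of_pos {t : ℝ} (ht : 0 < t) :
    truncatedPayoff t = ((max (t⁻¹ - 1) 0 : ℝ) : ℂ) := by
  unfold truncatedPayoff
  by_cases h : t ≤ 1
  · have hmem : t ∈ Set.Ioc (0 : ℝ) 1 := ⟨ht, h⟩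
    rw [max_eq_left (sub_nonneg.2 ((one_le_inv₀ ht).2 h))]
    simp [hmem, cpow_neg_one]
  · have hmem : t ∉ Set.Ioc (0 : ℝ) 1 := fun h' => h h'.2
    rw [max_eq_right (sub_nonpos.2 (inv_le_one_of_one_le₀ (not_le.1 h).le))]
    simp [hmem]

lemma continuousAt_truncatedPayoff {t : ℝ} (ht : 0 < t) : ContinuousAt truncatedPayoff t := by
  have h : ContinuousAt (fun t : ℝ => ((max (t⁻¹ - 1) 0 : ℝ) : ℂ)) t := by
    have := ht.ne'
    fun_prop (disch := assumption)
  refine h.congr ?_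
  filter_upwards [lt_mem_nhds ht] with u hu using (truncatedPayoff_of_pos hu).symm

lemma hasMellin_truncatedPayoff {z : ℂ} (hz : 1 < z.re) :
    HasMellin truncatedPayoff z (1 / (z * (z - 1))) := by
  have h₁ : HasMellin (Set.indicator (Set.Ioc 0 1) (fun t : ℝ => (t : ℂ) ^ (-1 : ℂ))) z
      (1 / (z + -1)) := hasMellin_cpow_Ioc (-1) (by simp; linarith)
  have h₂ := hasMellin_one_Ioc (s := z) (by linarith)
  have h := hasMellin_sub h₁.1 h₂.1
  refine ⟨h.1, h.2.trans ?_⟩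
  rw [h₁.2, h₂.2]
  have hz0 : z ≠ 0 := by rintro rfl; norm_num at hz
  have hz1 : z - 1 ≠ 0 := fun h => by rw [sub_eq_zero.1 h] at hz; norm_num at hz
  rw [← sub_eq_add_neg]
  field_simp
  ring

lemma integrable_one_div_mul_sub_one {R : ℝ} (hR : 1 < R) :
    Integrable (fun v : ℝ => 1 / (((R : ℂ) + v * I) * ((R : ℂ) + v * I - 1))) := by
  have hre (v : ℝ) : ((R : ℂ) + v * I).re = R := by simp
  have h0 (v : ℝ) : (R : ℂ) + v * I ≠ 0 := fun h => by
    have := congrArg re h; rw [hre] at this; simp at this; linarith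
  have h1 (v : ℝ) : (R : ℂ) + v * I - 1 ≠ 0 := fun h => by
    have := congrArg re h; rw [sub_re, hre] at this; simp at this; linarith
  have hc : 0 < min ((R - 1) ^ 2) 1 := lt_min (by nlinarith) one_pos
  set c := min ((R - 1) ^ 2) 1
  refine (integrable_inv_one_add_sq.const_mul c⁻¹).mono' ?_ (.of_forall fun v => ?_)
  · refine Continuous.aestronglyMeasurable ?_
    exact continuous_const.div (by fun_prop) fun v => mul_ne_zero (h0 v) (h1 v)
  · have hc₁ : c ≤ (R - 1) ^ 2 := min_le_left _ _
    have hc₂ : c ≤ 1 := min_le_right _ _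
    have hn : ‖(R : ℂ) + v * I - 1‖ ^ 2 = (R - 1) ^ 2 + v ^ 2 := by
      rw [← normSq_eq_norm_sq, normSq_apply]; simp; ring
    have hn' : ‖(R : ℂ) + v * I‖ ^ 2 = R ^ 2 + v ^ 2 := by
      rw [← normSq_eq_norm_sq, normSq_apply]; simp; ring
    have hle : ‖(R : ℂ) + v * I - 1‖ ≤ ‖(R : ℂ) + v * I‖ := by
      refine le_of_sq_le_sq ?_ (norm_nonneg _)
      rw [hn, hn']; nlinarith
    rw [norm_div, norm_one, norm_mul, one_div, ← mul_inv]
    refine inv_anti₀ (by positivity) ?_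
    calc c * (1 + v ^ 2) ≤ ‖(R : ℂ) + v * I - 1‖ ^ 2 := by
          rw [hn]; nlinarith [sq_nonneg v]
      _ ≤ _ := by rw [sq]; gcongr

lemma cpow_mul_cpow_one_sub {K s : ℝ} (hK : 0 < K) (hs : 0 < s) (z : ℂ) :
    (s : ℂ) ^ z * (K : ℂ) ^ (1 - z) = K * ((K / s : ℝ) : ℂ) ^ (-z) := by
  have hK' : (K : ℂ) ≠ 0 := ofReal_ne_zero.2 hK.ne'
  rw [div_eq_mul_inv, ofReal_mul, mul_cpow_ofReal_nonneg hK.le (inv_nonneg.2 hs.le), ofReal_inv,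
    inv_cpow _ _ (by rw [arg_ofReal_of_nonneg hs.le]; exact Real.pi_pos.ne), cpow_neg (s : ℂ),
    inv_inv, sub_eq_add_neg, cpow_add _ _ hK', cpow_one]
  ring

/-- Bromwich/Mellin inversion formula for the European call payoff:
`(s−K)⁺ = (1/2π) ∫ s^{R+iv} K^{1−R−iv} / ((R+iv)(R+iv−1)) dv` for `R > 1`. -/
theorem call_inversion (K s R : ℝ) (hK : 0 < K) (hs : 0 < s) (hR : 1 < R) :
    Integrable (fun v : ℝ => (s : ℂ) ^ ((R : ℂ) + v * Complex.I)
      * (K : ℂ) ^ ((1 : ℂ) - ((R : ℂ) + v * Complex.I))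
      / (((R : ℂ) + v * Complex.I) * ((R : ℂ) + v * Complex.I - 1))) ∧
    (↑(max (s - K) 0) : ℂ) = (1 / (2 * (Real.pi : ℂ)))
      * ∫ v : ℝ, (s : ℂ) ^ ((R : ℂ) + v * Complex.I)
          * (K : ℂ) ^ ((1 : ℂ) - ((R : ℂ) + v * Complex.I))
          / (((R : ℂ) + v * Complex.I) * ((R : ℂ) + v * Complex.I - 1)) := by
  have hx : 0 < K / s := div_pos hK hs
  have hmellin (v : ℝ) : mellin truncatedPayoff ((R : ℂ) + v * I) =
      1 / (((R : ℂ) + v * I) * ((R : ℂ) + v * I - 1)) :=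
    (hasMellin_truncatedPayoff (by simpa using hR)).2
  have hint := integrable_one_div_mul_sub_one hR
  have hintegrand (v : ℝ) : (s : ℂ) ^ ((R : ℂ) + v * I) * (K : ℂ) ^ ((1 : ℂ) - ((R : ℂ) + v * I))
      / (((R : ℂ) + v * I) * ((R : ℂ) + v * I - 1)) =
      K * (((K / s : ℝ) : ℂ) ^ (-((R : ℂ) + v * I)) •
        mellin truncatedPayoff ((R : ℂ) + v * I)) := by
    rw [cpow_mul_cpow_one_sub hK hs, hmellin, smul_eq_mul]
    ring
  simp_rw [hintegrand]
  constructor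
  · refine Integrable.const_mul ?_ _
    simp_rw [hmellin]
    refine hint.bdd_mul (c := (K / s) ^ (-R)) (Continuous.aestronglyMeasurable ?_)
      (.of_forall fun v => ?_)
    · exact Continuous.const_cpow (by fun_prop) (.inl (ofReal_ne_zero.2 hx.ne'))
    · rw [norm_cpow_eq_rpow_re_of_pos hx]
      simp
  · have hinv := mellinInv_mellin_eq R truncatedPayoff hx
      (hasMellin_truncatedPayoff (by simpa using hR)).1
      (by simpa only [VerticalIntegrable, hmellin] using hint) (continuousAt_truncatedPayoff hx)
    rw [truncatedPayoff_of_pos hx, mellinInv, real_smul] at hinv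
    push_cast at hinv
    rw [integral_const_mul, mul_left_comm]
    have hpay : max (s - K) 0 = K * max ((K / s)⁻¹ - 1) 0 := by
      rw [mul_max_of_nonneg _ _ hK.le, mul_zero]
      congr 1
      field_simp
    rw [hpay]
    push_cast
    rw [hinv]
end

section
/- Let K > 0, R < 0 and s > 0. Then the function v ↦ s^{R+iv} K^{1−R−iv} / ((R+iv)(R+iv−1)) is Lebesgue integrable on ℝ and the put payoff satisfies max(K − s, 0) = (1/2π) ∫_{−∞}^{∞} s^{R+iv} K^{1−R−iv} / ((R+iv)(R+iv−1)) dv. -/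
open MeasureTheory Complex

/-- The Mellin transform of `t ↦ (1 - t)⁺` is `1 / (z (z + 1))` for `0 < re z`. -/
theorem hasMellin_max_one_sub {z : ℂ} (hz : 0 < z.re) :
    HasMellin (fun t : ℝ => ((max (1 - t) 0 : ℝ) : ℂ)) z (1 / (z * (z + 1))) := by
  have hz0 : z ≠ 0 := fun h => by simp [h] at hz
  have hz1 : z + 1 ≠ 0 := fun h => by
    have := congrArg re h
    simp at this
    linarith
  have h₁ := hasMellin_one_Ioc hz
  have h₂ := hasMellin_cpow_Ioc (s := z) 1 (by simp; linarith)
  have h := hasMellin_sub h₁.1 h₂.1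
  rw [h₁.2, h₂.2] at h
  have heq : Set.EqOn (fun t : ℝ => Set.indicator (Set.Ioc 0 1) (fun _ => (1 : ℂ)) t
      - Set.indicator (Set.Ioc 0 1) (fun t : ℝ => (t : ℂ) ^ (1 : ℂ)) t)
      (fun t : ℝ => ((max (1 - t) 0 : ℝ) : ℂ)) (Set.Ioi 0) := by
    intro t ht
    have ht : 0 < t := ht
    by_cases h1 : t ≤ 1
    · simp [ht, h1]
    · simp [h1, max_eq_right (show 1 - t ≤ 0 by linarith)]
  have heq' : Set.EqOn (fun t : ℝ => (t : ℂ) ^ (z - 1) •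
      (Set.indicator (Set.Ioc 0 1) (fun _ => (1 : ℂ)) t
        - Set.indicator (Set.Ioc 0 1) (fun t : ℝ => (t : ℂ) ^ (1 : ℂ)) t))
      (fun t : ℝ => (t : ℂ) ^ (z - 1) • ((max (1 - t) 0 : ℝ) : ℂ)) (Set.Ioi 0) :=
    fun t ht => congrArg ((t : ℂ) ^ (z - 1) • ·) (heq ht)
  refine ⟨h.1.congr_fun heq' measurableSet_Ioi, ?_⟩
  rw [show 1 / (z * (z + 1)) = 1 / z - 1 / (z + 1) by field_simp; ring, ← h.2]
  exact (setIntegral_congr_fun measurableSet_Ioi heq').symm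

/-- `1 / (z (z + 1))` is integrable along every vertical line `re z = σ` with `0 < σ`. -/
theorem verticalIntegrable_one_div_mul_add_one {σ : ℝ} (hσ : 0 < σ) :
    VerticalIntegrable (fun z : ℂ => 1 / (z * (z + 1))) σ := by
  have hz (y : ℝ) : (σ : ℂ) + y * I ≠ 0 := fun h => by
    have := congrArg re h
    simp at this
    linarith
  have hz1 (y : ℝ) : (σ : ℂ) + y * I + 1 ≠ 0 := fun h => by
    have := congrArg re h
    simp at this
    linarith
  refine (integrable_inv_one_add_sq.const_mul ((1 + σ ^ 2) / σ ^ 2)).mono'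
    (Continuous.aestronglyMeasurable ?_) (.of_forall fun y => ?_)
  · exact continuous_const.div (by fun_prop) fun y => mul_ne_zero (hz y) (hz1 y)
  · have hsq : ‖(σ : ℂ) + y * I‖ ^ 2 = σ ^ 2 + y ^ 2 := by
      rw [Complex.sq_norm, normSq_add_mul_I]
    have hle : ‖(σ : ℂ) + y * I‖ ≤ ‖(σ : ℂ) + y * I + 1‖ := by
      refine (sq_le_sq₀ (norm_nonneg _) (norm_nonneg _)).mp ?_
      rw [hsq, show (σ : ℂ) + y * I + 1 = ((σ + 1 : ℝ) : ℂ) + y * I by push_cast; ring,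
        Complex.sq_norm, normSq_add_mul_I]
      nlinarith
    have hprod : σ ^ 2 + y ^ 2 ≤ ‖(σ : ℂ) + y * I‖ * ‖(σ : ℂ) + y * I + 1‖ := by
      rw [← hsq, sq]
      gcongr
    rw [norm_div, norm_one, norm_mul]
    calc 1 / (‖(σ : ℂ) + y * I‖ * ‖(σ : ℂ) + y * I + 1‖) ≤ 1 / (σ ^ 2 + y ^ 2) := by
          gcongr
      _ ≤ (1 + σ ^ 2) / σ ^ 2 * (1 + y ^ 2)⁻¹ := by
          rw [← div_eq_mul_inv, div_div, div_le_div_iff₀ (by positivity) (by positivity)]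
          nlinarith [sq_nonneg y, sq_nonneg σ, sq_nonneg (σ * σ)]

/-- Inversion of the Mellin transform of `t ↦ (1 - t)⁺`. -/
theorem mellinInv_one_div_mul_add_one {σ x : ℝ} (hσ : 0 < σ) (hx : 0 < x) :
    mellinInv σ (fun z : ℂ => 1 / (z * (z + 1))) x = ((max (1 - x) 0 : ℝ) : ℂ) := by
  have hmellin (y : ℝ) : mellin (fun t : ℝ => ((max (1 - t) 0 : ℝ) : ℂ)) (σ + y * I)
      = 1 / ((σ + y * I) * (σ + y * I + 1)) :=
    (hasMellin_max_one_sub (by simpa using hσ)).2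
  rw [← mellinInv_mellin_eq σ (fun t : ℝ => ((max (1 - t) 0 : ℝ) : ℂ)) hx
    (hasMellin_max_one_sub (by simpa using hσ)).1 ?_ (by fun_prop)]
  · simp only [mellinInv, hmellin]
  · simpa only [VerticalIntegrable, hmellin] using verticalIntegrable_one_div_mul_add_one hσ

/-- inversion formula for the European put payoff:
`(K−s)⁺ = (1/2π) ∫ s^{R+iv} K^{1−R−iv} / ((R+iv)(R+iv−1)) dv` for `R < 0`. -/
theorem put_inversion (K s R : ℝ) (hK : 0 < K) (hs : 0 < s) (hR : R < 0) :
    Integrable (fun v : ℝ => (s : ℂ) ^ ((R : ℂ) + v * Complex.I)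
      * (K : ℂ) ^ ((1 : ℂ) - ((R : ℂ) + v * Complex.I))
      / (((R : ℂ) + v * Complex.I) * ((R : ℂ) + v * Complex.I - 1))) ∧
    (↑(max (K - s) 0) : ℂ) = (1 / (2 * (Real.pi : ℂ)))
      * ∫ v : ℝ, (s : ℂ) ^ ((R : ℂ) + v * Complex.I)
          * (K : ℂ) ^ ((1 : ℂ) - ((R : ℂ) + v * Complex.I))
          / (((R : ℂ) + v * Complex.I) * ((R : ℂ) + v * Complex.I - 1)) := by
  have hσ : 0 < -R := by linarith
  have hx : 0 < s / K := by positivity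
  have hK0 : (K : ℂ) ≠ 0 := ofReal_ne_zero.mpr hK.ne'
  have hx0 : ((s / K : ℝ) : ℂ) ≠ 0 := ofReal_ne_zero.mpr hx.ne'
  let g : ℝ → ℂ := fun y => ((s / K : ℝ) : ℂ) ^ (-(((-R : ℝ) : ℂ) + y * I)) •
    (1 / ((((-R : ℝ) : ℂ) + y * I) * (((-R : ℝ) : ℂ) + y * I + 1)))
  have hg : Integrable g := by
    refine (verticalIntegrable_one_div_mul_add_one hσ).bdd_mul (c := (s / K) ^ R)
      (Continuous.aestronglyMeasurable ?_) (.of_forall fun y => ?_)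
    · exact Continuous.const_cpow (by fun_prop) (.inl hx0)
    · rw [norm_cpow_eq_rpow_re_of_pos hx]
      simp
  have hfun : (fun v : ℝ => (s : ℂ) ^ ((R : ℂ) + v * I) * (K : ℂ) ^ ((1 : ℂ) - ((R : ℂ) + v * I))
      / (((R : ℂ) + v * I) * ((R : ℂ) + v * I - 1))) = fun v => (K : ℂ) * g (-v) := by
    funext v
    have hw : ((-R : ℝ) : ℂ) + ((-v : ℝ) : ℂ) * I = -((R : ℂ) + v * I) := by push_cast; ring
    have hsplit : (s : ℂ) = ((s / K : ℝ) : ℂ) * (K : ℂ) := by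
      push_cast
      field_simp
    simp only [g, hw, neg_neg, smul_eq_mul]
    generalize (R : ℂ) + v * I = w
    rw [hsplit, mul_cpow_ofReal_nonneg hx.le hK.le, mul_assoc, ← cpow_add _ _ hK0,
      show w + (1 - w) = 1 by ring, cpow_one, show -w * (-w + 1) = w * (w - 1) by ring]
    ring
  rw [hfun]
  refine ⟨hg.comp_neg.const_mul _, ?_⟩
  have hinv := mellinInv_one_div_mul_add_one hσ hx
  have hmax : max (K - s) 0 = K * max (1 - s / K) 0 := by
    rw [mul_max_of_nonneg _ _ hK.le, mul_zero, mul_sub, mul_one, mul_div_cancel₀ _ hK.ne']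
  rw [integral_const_mul, integral_neg_eq_self g volume, hmax, ofReal_mul, ← hinv, mellinInv]
  simp only [real_smul, g]
  push_cast
  ring
end

section
/- Let K > 0, 0 < R < 1 and s > 0. Then the function v ↦ s^{R+iv} K^{1−R−iv} / ((R+iv)(R+iv−1)) is Lebesgue integrable on ℝ and max(s − K, 0) − s = (1/2π) ∫_{−∞}^{∞} s^{R+iv} K^{1−R−iv} / ((R+iv)(R+iv−1)) dv. -/
open MeasureTheory Complex

theorem hasMellin_cpow_Ioi {a z : ℂ} (hz : z.re + a.re < 0) :
    HasMellin (Set.indicator (Set.Ioi 1) (fun t : ℝ => (t : ℂ) ^ a)) z (-1 / (z + a)) := by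
  have hre : (z - 1 + a).re < -1 := by
    simp only [add_re, sub_re, one_re]
    linarith
  have hmul : ∀ t ∈ Set.Ioi (1 : ℝ), (t : ℂ) ^ (z - 1) * (t : ℂ) ^ a = (t : ℂ) ^ (z - 1 + a) :=
    fun t ht => (cpow_add _ _ (ofReal_ne_zero.mpr (zero_lt_one.trans ht).ne')).symm
  have hsub : Set.Ioi (1 : ℝ) ⊆ Set.Ioi 0 := Set.Ioi_subset_Ioi zero_le_one
  simp_rw [HasMellin, mellin, MellinConvergent, ← Set.indicator_smul]
  rw [integrableOn_indicator_iff measurableSet_Ioi, setIntegral_indicator measurableSet_Ioi,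
    Set.inter_eq_left.mpr hsub, Set.inter_eq_right.mpr hsub]
  simp only [smul_eq_mul]
  rw [setIntegral_congr_fun measurableSet_Ioi hmul, integrableOn_congr_fun hmul measurableSet_Ioi,
    integral_Ioi_cpow_of_lt hre zero_lt_one]
  refine ⟨integrableOn_Ioi_cpow_of_lt hre zero_lt_one, ?_⟩
  rw [ofReal_one, one_cpow]
  congr 1
  ring

/-- The Mellin transform of `t ↦ min 1 t⁻¹` on the strip `0 < re z < 1`. -/
theorem hasMellin_min_one_inv {z : ℂ} (hz0 : 0 < z.re) (hz1 : z.re < 1) :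
    HasMellin (fun t : ℝ => ((min 1 t⁻¹ : ℝ) : ℂ)) z (-1 / (z * (z - 1))) := by
  have h₁ := hasMellin_one_Ioc hz0
  have h₂ := hasMellin_cpow_Ioi (a := -1) (z := z) (by simpa using hz1)
  have h := hasMellin_add h₁.1 h₂.1
  rw [h₁.2, h₂.2] at h
  have hne0 : z ≠ 0 := by rintro rfl; simp at hz0
  have hne1 : z - 1 ≠ 0 := by
    intro h0
    rw [sub_eq_zero.mp h0] at hz1
    simp at hz1
  have hcongr : ∀ t ∈ Set.Ioi (0 : ℝ),
      (t : ℂ) ^ (z - 1) • (Set.indicator (Set.Ioc 0 1) (fun _ => (1 : ℂ)) t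
        + Set.indicator (Set.Ioi 1) (fun t : ℝ => (t : ℂ) ^ (-1 : ℂ)) t)
      = (t : ℂ) ^ (z - 1) • ((min 1 t⁻¹ : ℝ) : ℂ) := by
    intro t ht
    have ht0 : 0 < t := ht
    congr 1
    rcases le_or_gt t 1 with h1 | h1
    · rw [min_eq_left ((one_le_inv₀ ht0).mpr h1)]
      simp [ht0, h1]
    · rw [min_eq_right (inv_le_one_of_one_le₀ h1.le)]
      simp [h1, h1.not_ge, cpow_neg_one]
  refine ⟨(integrableOn_congr_fun hcongr measurableSet_Ioi).mp h.1, ?_⟩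
  have hval : mellin (fun t : ℝ => ((min 1 t⁻¹ : ℝ) : ℂ)) z = 1 / z + -1 / (z + -1) :=
    (setIntegral_congr_fun measurableSet_Ioi hcongr).symm.trans h.2
  rw [hval, ← sub_eq_add_neg]
  field_simp
  ring

theorem integrable_inv_mul_sub_one {R : ℝ} (hR0 : 0 < R) (hR1 : R < 1) :
    Integrable (fun v : ℝ => (((R : ℂ) + v * I) * ((R : ℂ) + v * I - 1))⁻¹) := by
  have hne0 : ∀ v : ℝ, (R : ℂ) + v * I ≠ 0 := fun v h => by
    simpa [hR0.ne'] using congrArg re h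
  have hne1 : ∀ v : ℝ, (R : ℂ) + v * I - 1 ≠ 0 := fun v h => by
    have := congrArg re h
    simp at this
    linarith
  have hcont : Continuous (fun v : ℝ => (((R : ℂ) + v * I) * ((R : ℂ) + v * I - 1))⁻¹) :=
    Continuous.inv₀ (by fun_prop) fun v => mul_ne_zero (hne0 v) (hne1 v)
  have hc : 0 < R * (1 - R) := mul_pos hR0 (sub_pos.mpr hR1)
  refine (integrable_inv_one_add_sq.const_mul ((R * (1 - R)) ^ 2)⁻¹).mono'
    hcont.aestronglyMeasurable (Filter.Eventually.of_forall fun v => ?_)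
  rw [norm_inv, ← mul_inv]
  refine inv_anti₀ (by positivity) (le_of_sq_le_sq ?_ (norm_nonneg _))
  have hnorm : ‖((R : ℂ) + v * I) * ((R : ℂ) + v * I - 1)‖ ^ 2
      = (R ^ 2 + v ^ 2) * ((1 - R) ^ 2 + v ^ 2) := by
    rw [← normSq_eq_norm_sq, normSq_mul, normSq_apply, normSq_apply]
    simp
    ring
  have hcR : (R * (1 - R)) ^ 2 ≤ R ^ 2 := pow_le_pow_left₀ hc.le (by nlinarith) 2
  have hcR' : (R * (1 - R)) ^ 2 ≤ (1 - R) ^ 2 := pow_le_pow_left₀ hc.le (by nlinarith) 2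
  have hc1 : (R * (1 - R)) ^ 2 ≤ 1 := pow_le_one₀ hc.le (by nlinarith)
  rw [hnorm, sq ((R * (1 - R)) ^ 2 * (1 + v ^ 2))]
  have hv := mul_le_mul_of_nonneg_right hc1 (sq_nonneg v)
  exact mul_le_mul (by linarith) (by linarith) (by positivity) (by positivity)

/-- inversion formula for the call-minus-stock payoff:
`(s−K)⁺ − s = (1/2π) ∫ s^{R+iv} K^{1−R−iv} / ((R+iv)(R+iv−1)) dv` for `0 < R < 1`. -/
theorem call_minus_stock_inversion (K s R : ℝ) (hK : 0 < K) (hs : 0 < s)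
    (hR0 : 0 < R) (hR1 : R < 1) :
    Integrable (fun v : ℝ => (s : ℂ) ^ ((R : ℂ) + v * Complex.I)
      * (K : ℂ) ^ ((1 : ℂ) - ((R : ℂ) + v * Complex.I))
      / (((R : ℂ) + v * Complex.I) * ((R : ℂ) + v * Complex.I - 1))) ∧
    (↑(max (s - K) 0 - s) : ℂ) = (1 / (2 * (Real.pi : ℂ)))
      * ∫ v : ℝ, (s : ℂ) ^ ((R : ℂ) + v * Complex.I)
          * (K : ℂ) ^ ((1 : ℂ) - ((R : ℂ) + v * Complex.I))
          / (((R : ℂ) + v * Complex.I) * ((R : ℂ) + v * Complex.I - 1)) := by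
  have hsC : (s : ℂ) ≠ 0 := ofReal_ne_zero.mpr hs.ne'
  have hKC : (K : ℂ) ≠ 0 := ofReal_ne_zero.mpr hK.ne'
  have hx : 0 < K / s := div_pos hK hs
  have hmellin : ∀ v : ℝ, mellin (fun t : ℝ => ((min 1 t⁻¹ : ℝ) : ℂ)) ((R : ℂ) + v * I)
      = -1 / (((R : ℂ) + v * I) * ((R : ℂ) + v * I - 1)) := fun v =>
    (hasMellin_min_one_inv (by simpa using hR0) (by simpa using hR1)).2
  have hvert : VerticalIntegrable (mellin (fun t : ℝ => ((min 1 t⁻¹ : ℝ) : ℂ))) R := by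
    simp_rw [VerticalIntegrable, hmellin, neg_div, one_div]
    exact (integrable_inv_mul_sub_one hR0 hR1).neg
  have hcont : ContinuousAt (fun t : ℝ => ((min 1 t⁻¹ : ℝ) : ℂ)) (K / s) :=
    continuous_ofReal.continuousAt.comp
      (continuousAt_const.min (continuousAt_inv₀ hx.ne'))
  have hinv := mellinInv_mellin_eq R _ hx
    (hasMellin_min_one_inv (z := (R : ℂ)) (by simpa using hR0) (by simpa using hR1)).1 hvert hcont
  have hpow : ∀ z : ℂ, (s : ℂ) ^ z * (K : ℂ) ^ (1 - z) = K * ((K / s : ℝ) : ℂ) ^ (-z) := by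
    intro z
    rw [ofReal_div, div_cpow_ofReal_nonneg hK.le hs.le, sub_eq_add_neg, cpow_add _ _ hKC, cpow_one,
      cpow_neg (s : ℂ), div_inv_eq_mul]
    ring
  constructor
  · refine (integrable_inv_mul_sub_one hR0 hR1).bdd_mul (c := s ^ R * K ^ (1 - R))
      (Continuous.aestronglyMeasurable ?_) (Filter.Eventually.of_forall fun v => ?_)
    · exact (Continuous.const_cpow (by fun_prop) (Or.inl hsC)).mul
        (Continuous.const_cpow (by fun_prop) (Or.inl hKC))
    · rw [norm_mul, norm_cpow_eq_rpow_re_of_pos hs, norm_cpow_eq_rpow_re_of_pos hK]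
      simp
  · have hpayoff : max (s - K) 0 - s = -(K * min 1 (K / s)⁻¹) := by
      rw [mul_min_of_nonneg _ _ hK.le, inv_div, mul_div_cancel₀ _ hK.ne', mul_one]
      rcases le_total s K with h | h
      · rw [max_eq_right (by linarith), min_eq_right h]
        ring
      · rw [max_eq_left (by linarith), min_eq_left h]
        ring
    have hintegrand : ∀ v : ℝ, (s : ℂ) ^ ((R : ℂ) + v * I) * (K : ℂ) ^ (1 - ((R : ℂ) + v * I))
        / (((R : ℂ) + v * I) * ((R : ℂ) + v * I - 1))
        = -K * (((K / s : ℝ) : ℂ) ^ (-((R : ℂ) + v * I))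
          • mellin (fun t : ℝ => ((min 1 t⁻¹ : ℝ) : ℂ)) ((R : ℂ) + v * I)) := by
      intro v
      rw [hpow, hmellin, smul_eq_mul]
      ring
    simp_rw [hintegrand]
    rw [integral_const_mul, hpayoff, ofReal_neg, ofReal_mul, ← hinv, mellinInv, real_smul]
    push_cast
    ring
end

section
/- Let K > 0, let n ≥ 1 be an integer, let R > n and s > 0. Then the function v ↦ s^{R+iv} n! K^{n−R−iv} / ∏_{j=0}^{n} (R+iv−j) is Lebesgue integrable on ℝ and the power call payoff satisfies (max(s − K, 0))^n = (1/2π) ∫_{−∞}^{∞} s^{R+iv} n! K^{n−R−iv} / ((R+iv)(R+iv−1)⋯(R+iv−n)) dv. -/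
open MeasureTheory Complex Finset

/-- The Mellin transform of `x ↦ ((1 - x)⁺)ⁿ` is a Beta integral. -/
lemma hasMellin_max_one_sub_pow (n : ℕ) (hn : n ≠ 0) {u : ℂ} (hu : 0 < u.re) :
    HasMellin (fun x : ℝ => (↑(max (1 - x) 0 ^ n) : ℂ)) u
      (n.factorial / ∏ j ∈ range (n + 1), (u + j)) := by
  have hsupp : (fun x : ℝ => (x : ℂ) ^ (u - 1) • (↑(max (1 - x) 0 ^ n) : ℂ)) =
      (Set.Iic (1 : ℝ)).indicator
        (fun x : ℝ => (x : ℂ) ^ (u - 1) * (1 - (x : ℂ)) ^ ((n + 1 : ℂ) - 1)) := by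
    ext x
    by_cases hx : x ≤ 1
    · rw [Set.indicator_of_mem (show x ∈ Set.Iic (1 : ℝ) from hx), max_eq_left (by linarith)]
      simp
    · rw [Set.indicator_of_notMem (show x ∉ Set.Iic (1 : ℝ) from hx), max_eq_right (by linarith)]
      simp [hn]
  have hset : Set.Ioi (0 : ℝ) ∩ Set.Iic 1 = Set.Ioc 0 1 := Set.Ioi_inter_Iic
  have hn' : 0 < ((n : ℂ) + 1).re := by
    simp only [add_re, natCast_re, one_re]
    positivity
  constructor
  · rw [MellinConvergent, hsupp, integrableOn_indicator_iff measurableSet_Iic, Set.inter_comm, hset]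
    exact (intervalIntegrable_iff_integrableOn_Ioc_of_le zero_le_one).mp
      (betaIntegral_convergent hu hn')
  · rw [mellin, hsupp, setIntegral_indicator measurableSet_Iic, hset,
      ← intervalIntegral.integral_of_le zero_le_one, ← betaIntegral_eval_nat_add_one_right hu n,
      betaIntegral]

lemma prod_add_natCast_ne_zero (n : ℕ) {u : ℂ} (hu : 0 < u.re) :
    ∏ j ∈ range n, (u + j) ≠ 0 := by
  refine prod_ne_zero_iff.mpr fun j _ h => ?_
  have := congrArg re h
  simp only [add_re, natCast_re, zero_re] at this
  have : (0 : ℝ) ≤ j := j.cast_nonneg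
  linarith

lemma norm_pow_le_norm_prod_add_natCast (n : ℕ) {u : ℂ} (hu : 0 < u.re) :
    ‖u‖ ^ n ≤ ‖∏ j ∈ range n, (u + j)‖ := by
  rw [norm_prod, ← card_range n, ← prod_const, card_range]
  refine prod_le_prod (fun _ _ => norm_nonneg _) fun j _ => ?_
  rw [Complex.norm_def, Complex.norm_def]
  refine Real.sqrt_le_sqrt ?_
  have : (0 : ℝ) ≤ j := j.cast_nonneg
  simp only [normSq_apply, add_re, natCast_re, add_im, natCast_im, add_zero]
  nlinarith

lemma verticalIntegrable_div_prod_add_natCast (c : ℂ) (n : ℕ) (hn : 1 ≤ n) {σ : ℝ} (hσ : 0 < σ) :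
    VerticalIntegrable (fun u : ℂ => c / ∏ j ∈ range (n + 1), (u + j)) σ := by
  have hre (v : ℝ) : 0 < ((σ : ℂ) + v * I).re := by simpa using hσ
  have hm : 0 < min 1 (σ ^ 2) := by positivity
  refine (integrable_inv_one_add_sq.const_mul (‖c‖ * (σ ^ (n - 1) * min 1 (σ ^ 2))⁻¹)).mono'
    (Continuous.aestronglyMeasurable ?_) (.of_forall fun v => ?_)
  · exact continuous_const.div (by fun_prop) fun v => prod_add_natCast_ne_zero _ (hre v)
  rw [norm_div, mul_assoc, ← mul_inv, ← div_eq_mul_inv]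
  refine div_le_div_of_nonneg_left (norm_nonneg _) (by positivity) ?_
  refine le_trans ?_ (norm_pow_le_norm_prod_add_natCast (n + 1) (hre v))
  have hnorm : σ ≤ ‖(σ : ℂ) + v * I‖ := by
    simpa using (le_abs_self _).trans (abs_re_le_norm ((σ : ℂ) + v * I))
  have hsq : ‖(σ : ℂ) + v * I‖ ^ 2 = σ ^ 2 + v ^ 2 := by
    rw [← normSq_eq_norm_sq, normSq_add_mul_I]
  rw [show n + 1 = (n - 1) + 2 by omega, pow_add, hsq, mul_assoc]
  gcongr
  nlinarith [min_le_left 1 (σ ^ 2), min_le_right 1 (σ ^ 2), sq_nonneg v]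

lemma prod_range_sub_natCast_eq (n : ℕ) (z : ℂ) :
    ∏ j ∈ range (n + 1), (z - j) = ∏ j ∈ range (n + 1), (z - n + j) := by
  rw [← prod_range_reflect]
  refine prod_congr rfl fun j hj => ?_
  have : j ≤ n := by simpa [Nat.lt_succ_iff] using hj
  rw [show n + 1 - 1 - j = n - j by omega, Nat.cast_sub this]
  ring

/-- inversion formula for the integer power call payoff:
`((s−K)⁺)ⁿ = (1/2π) ∫ s^{R+iv} n! K^{n−R−iv} / ((R+iv)(R+iv−1)⋯(R+iv−n)) dv` for `R > n`. -/
theorem power_call_inversion (K s R : ℝ) (n : ℕ) (hn : 1 ≤ n)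
    (hK : 0 < K) (hs : 0 < s) (hR : (n : ℝ) < R) :
    Integrable (fun v : ℝ => (s : ℂ) ^ ((R : ℂ) + v * Complex.I)
      * (n.factorial : ℂ) * (K : ℂ) ^ ((n : ℂ) - ((R : ℂ) + v * Complex.I))
      / ∏ j ∈ Finset.range (n + 1), ((R : ℂ) + v * Complex.I - (j : ℂ))) ∧
    (↑(max (s - K) 0 ^ n) : ℂ) = (1 / (2 * (Real.pi : ℂ)))
      * ∫ v : ℝ, (s : ℂ) ^ ((R : ℂ) + v * Complex.I)
          * (n.factorial : ℂ) * (K : ℂ) ^ ((n : ℂ) - ((R : ℂ) + v * Complex.I))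
          / ∏ j ∈ Finset.range (n + 1), ((R : ℂ) + v * Complex.I - (j : ℂ)) := by
  have hσ : 0 < R - n := sub_pos.mpr hR
  have hx : 0 < K / s := div_pos hK hs
  have hre (v : ℝ) : 0 < (((R - n : ℝ) : ℂ) + v * I).re := by simpa using hR
  set f : ℝ → ℂ := fun x => (↑(max (1 - x) 0 ^ n) : ℂ)
  have hmellin (v : ℝ) : mellin f (((R - n : ℝ) : ℂ) + v * I) =
      n.factorial / ∏ j ∈ range (n + 1), (((R - n : ℝ) : ℂ) + v * I + j) :=
    (hasMellin_max_one_sub_pow n (by omega) (hre v)).2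
  have hvert : VerticalIntegrable (mellin f) (R - n) := by
    simpa only [VerticalIntegrable, hmellin] using
      verticalIntegrable_div_prod_add_natCast n.factorial n hn hσ
  have hinv := mellinInv_mellin_eq (R - n) f hx
    (hasMellin_max_one_sub_pow n (by omega) (by simpa using hR)).1 hvert
    (by fun_prop)
  have hintegrand (v : ℝ) : (s : ℂ) ^ ((R : ℂ) + v * I) * (n.factorial : ℂ)
      * (K : ℂ) ^ ((n : ℂ) - ((R : ℂ) + v * I)) / ∏ j ∈ range (n + 1), ((R : ℂ) + v * I - (j : ℂ)) =
      (s : ℂ) ^ n * (((K / s : ℝ) : ℂ) ^ (-(((R - n : ℝ) : ℂ) + v * I))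
        * mellin f (((R - n : ℝ) : ℂ) + v * I)) := by
    have hs0 : (s : ℂ) ≠ 0 := ofReal_ne_zero.mpr hs.ne'
    have hKs : (K : ℂ) = ((K / s : ℝ) : ℂ) * (s : ℂ) := by
      rw [← ofReal_mul, div_mul_cancel₀ _ hs.ne']
    have hpow : (s : ℂ) ^ ((R : ℂ) + v * I) * (s : ℂ) ^ ((n : ℂ) - ((R : ℂ) + v * I)) =
        (s : ℂ) ^ n := by
      rw [← cpow_add _ _ hs0, add_sub_cancel, cpow_natCast]
    rw [hmellin, prod_range_sub_natCast_eq, hKs, mul_cpow_ofReal_nonneg hx.le hs.le, ← hpow,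
      show (n : ℂ) - ((R : ℂ) + v * I) = -(((R - n : ℝ) : ℂ) + v * I) by push_cast; ring,
      show (R : ℂ) + v * I - n = ((R - n : ℝ) : ℂ) + v * I by push_cast; ring]
    ring
  simp only [hintegrand]
  constructor
  · refine Integrable.const_mul (Integrable.bdd_mul (c := (K / s) ^ (-(R - n))) hvert ?_
      (.of_forall fun v => ?_)) _
    · refine Continuous.aestronglyMeasurable (Continuous.const_cpow (by fun_prop) (.inl ?_))
      exact ofReal_ne_zero.mpr hx.ne'
    · rw [norm_cpow_eq_rpow_re_of_pos hx]
      simp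
  · have hpayoff : max (s - K) 0 ^ n = s ^ n * max (1 - K / s) 0 ^ n := by
      rw [← mul_pow, mul_max_of_nonneg _ _ hs.le, mul_zero, mul_sub, mul_one,
        mul_div_cancel₀ _ hs.ne']
    rw [integral_const_mul, hpayoff, ofReal_mul, ofReal_pow, mul_left_comm]
    congr 1
    rw [← show f (K / s) = ((max (1 - K / s) 0 ^ n : ℝ) : ℂ) from rfl, ← hinv, mellinInv]
    simp [real_smul]
end

section
/- Let K > 0, let α > 1 be a real number, let R > α and s > 0. Then the function v ↦ s^{R+iv} K^{α−R−iv} B(α+1, R+iv−α) is Lebesgue integrable on ℝ and (max(s − K, 0))^α = (1/2π) ∫_{−∞}^{∞} s^{R+iv} K^{α−R−iv} B(α+1, R+iv−α) dv, where B(a, b) = Γ(a)Γ(b)/Γ(a+b) is the Euler beta function and Γ the complex Gamma function. -/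
open MeasureTheory Complex

/-- For fixed `b`, the beta integral is bounded on vertical lines in its first argument. -/
lemma norm_betaIntegral_le (u b : ℂ) :
    ‖betaIntegral u b‖ ≤
      ∫ x in (0 : ℝ)..1, ‖(x : ℂ) ^ ((u.re : ℂ) - 1) * (1 - (x : ℂ)) ^ (b - 1)‖ := by
  refine (intervalIntegral.norm_integral_le_integral_norm zero_le_one).trans_eq ?_
  refine intervalIntegral.integral_congr_ae (Filter.Eventually.of_forall fun x hx => ?_)
  rw [Set.uIoc_of_le zero_le_one] at hx
  rw [norm_mul, norm_mul, norm_cpow_eq_rpow_re_of_pos hx.1, norm_cpow_eq_rpow_re_of_pos hx.1]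
  simp

/-- Quadratic decay of the beta integral along vertical lines when `re b > 2`. -/
lemma exists_norm_betaIntegral_vertical_le {σ : ℝ} (hσ : 0 < σ) {b : ℂ} (hb : 2 < b.re) :
    ∃ C : ℝ, ∀ v : ℝ, ‖betaIntegral (σ + v * I) b‖ ≤ C * (1 + v ^ 2)⁻¹ := by
  set M := ∫ x in (0 : ℝ)..1,
    ‖(x : ℂ) ^ (((σ + 2 : ℝ) : ℂ) - 1) * (1 - (x : ℂ)) ^ (b - 2 - 1)‖
  set c := min σ 1
  have hc : 0 < c := lt_min hσ one_pos
  refine ⟨‖b - 1‖ * ‖b - 2‖ * M / c, fun v => ?_⟩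
  set w : ℂ := σ + v * I with hw
  have hwre : w.re = σ := by simp [hw]
  have hwim : w.im = v := by simp [hw]
  have h1 := betaIntegral_recurrence (u := w) (v := b - 1) (by rwa [hwre])
    (by simp; linarith)
  have h2 := betaIntegral_recurrence (u := w + 1) (v := b - 2) (by simp [hwre]; linarith)
    (by simp; linarith)
  rw [show b - 1 + 1 = b by ring] at h1
  rw [show b - 2 + 1 = b - 1 by ring, show w + 1 + 1 = w + 2 by ring] at h2
  have hM : ‖betaIntegral (w + 2) (b - 2)‖ ≤ M := by
    simpa [hwre, M] using norm_betaIntegral_le (w + 2) (b - 2)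
  have hprod : ‖w‖ * ‖w + 1‖ * ‖betaIntegral w b‖ ≤ ‖b - 1‖ * ‖b - 2‖ * M := by
    have : w * (w + 1) * betaIntegral w b = (b - 1) * (b - 2) * betaIntegral (w + 2) (b - 2) := by
      linear_combination (w + 1) * h1 + (b - 1) * h2
    rw [← norm_mul, ← norm_mul, this, norm_mul, norm_mul]
    gcongr
  have hlow : c * (1 + v ^ 2) ≤ ‖w‖ * ‖w + 1‖ := by
    refine le_of_pow_le_pow_left₀ two_ne_zero (by positivity) ?_
    have hcσ : c ^ 2 ≤ σ ^ 2 := by gcongr; exact min_le_left _ _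
    have hc1 : c ^ 2 ≤ 1 := pow_le_one₀ hc.le (min_le_right _ _)
    have e1 : c ^ 2 * (1 + v ^ 2) ≤ ‖w‖ ^ 2 := by
      rw [Complex.sq_norm, normSq_apply, hwre, hwim]
      nlinarith [sq_nonneg v]
    have e2 : 1 + v ^ 2 ≤ ‖w + 1‖ ^ 2 := by
      rw [Complex.sq_norm, normSq_apply]
      simp only [add_re, add_im, one_re, one_im, hwre, hwim]
      nlinarith
    calc (c * (1 + v ^ 2)) ^ 2 = (c ^ 2 * (1 + v ^ 2)) * (1 + v ^ 2) := by ring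
      _ ≤ ‖w‖ ^ 2 * ‖w + 1‖ ^ 2 := by gcongr
      _ = _ := by ring
  rw [← div_eq_mul_inv, div_div, le_div_iff₀ (by positivity), mul_comm]
  exact (mul_le_mul_of_nonneg_right hlow (norm_nonneg _)).trans hprod

lemma continuous_betaIntegral_vertical {σ : ℝ} (hσ : 0 < σ) {b : ℂ} (hb : 0 < b.re) :
    Continuous fun v : ℝ => betaIntegral (σ + v * I) b := by
  have hG (a : ℂ) (ha : 0 < a.re) : Continuous fun v : ℝ => Gamma (a + v * I) := by
    refine continuous_iff_continuousAt.2 fun v => ?_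
    have hd : DifferentiableAt ℂ Gamma (a + v * I) :=
      differentiableAt_Gamma _ fun m h => by
        have := congrArg re h
        simp at this
        linarith [(Nat.cast_nonneg m : (0 : ℝ) ≤ m)]
    exact hd.continuousAt.comp (f := fun v : ℝ => a + v * I) (by fun_prop)
  have heq (v : ℝ) : betaIntegral (σ + v * I) b =
      Gamma (σ + v * I) * Gamma b / Gamma (σ + b + v * I) := by
    rw [betaIntegral_eq_Gamma_mul_div _ _ (by simpa using hσ) hb, add_right_comm]
  simp_rw [heq]
  refine ((hG _ (by simpa using hσ)).mul continuous_const).div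
    (hG _ (by simp; linarith)) fun v => Gamma_ne_zero_of_re_pos ?_
  simp
  linarith

lemma verticalIntegrable_betaIntegral {σ : ℝ} (hσ : 0 < σ) {b : ℂ} (hb : 2 < b.re) :
    VerticalIntegrable (fun w => betaIntegral w b) σ := by
  obtain ⟨C, hC⟩ := exists_norm_betaIntegral_vertical_le hσ hb
  exact (integrable_inv_one_add_sq.const_mul C).mono'
    (continuous_betaIntegral_vertical hσ (by linarith)).aestronglyMeasurable
    (Filter.Eventually.of_forall hC)

/-- The Mellin transform of the truncated power `t ↦ ((1 - t)⁺) ^ α` is a beta integral. -/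
lemma hasMellin_max_one_sub_rpow {α : ℝ} (hα : 0 < α) {w : ℂ} (hw : 0 < w.re) :
    HasMellin (fun t : ℝ => ((max (1 - t) 0 ^ α : ℝ) : ℂ)) w (betaIntegral w (α + 1)) := by
  have hzero : ∀ t ∈ Set.Ioi (0 : ℝ), t ∉ Set.Ioc (0 : ℝ) 1 →
      (t : ℂ) ^ (w - 1) • ((max (1 - t) 0 ^ α : ℝ) : ℂ) = 0 := by
    intro t ht ht'
    have h1 : 1 < t := by
      by_contra! h
      exact ht' ⟨ht, h⟩
    rw [max_eq_right (by linarith), Real.zero_rpow hα.ne']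
    simp
  have hpow : Set.EqOn (fun t : ℝ => (t : ℂ) ^ (w - 1) * (1 - (t : ℂ)) ^ ((α : ℂ) + 1 - 1))
      (fun t : ℝ => (t : ℂ) ^ (w - 1) • ((max (1 - t) 0 ^ α : ℝ) : ℂ)) (Set.Ioc 0 1) := by
    intro t ht
    have h1 : 0 ≤ 1 - t := by linarith [ht.2]
    simp [max_eq_left h1, ofReal_cpow h1]
  have hconv := betaIntegral_convergent hw (v := (α : ℂ) + 1) (by simp; linarith)
  rw [intervalIntegrable_iff_integrableOn_Ioc_of_le zero_le_one] at hconv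
  refine ⟨?_, ?_⟩
  · exact (hconv.congr_fun hpow measurableSet_Ioc).of_forall_sdiff_eq_zero measurableSet_Ioi
      fun t ht => hzero t ht.1 ht.2
  · rw [mellin, betaIntegral, intervalIntegral.integral_of_le zero_le_one,
      setIntegral_congr_fun measurableSet_Ioc hpow]
    exact setIntegral_eq_of_subset_of_forall_sdiff_eq_zero measurableSet_Ioi
      (fun t ht => ht.1) fun t ht => hzero t ht.1 ht.2

/-- inversion formula for the fractional power call payoff:
`((s−K)⁺)^α = (1/2π) ∫ s^{R+iv} K^{α−R−iv} B(α+1, R+iv−α) dv` for real `α > 1`, `R > α`,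
where `B(a,b) = Γ(a)Γ(b)/Γ(a+b)`. -/
theorem fractional_power_call_inversion (K s R α : ℝ) (hα : 1 < α)
    (hK : 0 < K) (hs : 0 < s) (hR : α < R) :
    Integrable (fun v : ℝ => (s : ℂ) ^ ((R : ℂ) + v * Complex.I)
      * (K : ℂ) ^ ((α : ℂ) - ((R : ℂ) + v * Complex.I))
      * (Complex.Gamma ((α : ℂ) + 1) * Complex.Gamma ((R : ℂ) + v * Complex.I - (α : ℂ))
          / Complex.Gamma ((R : ℂ) + v * Complex.I + 1))) ∧
    (↑(max (s - K) 0 ^ α) : ℂ) = (1 / (2 * (Real.pi : ℂ)))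
      * ∫ v : ℝ, (s : ℂ) ^ ((R : ℂ) + v * Complex.I)
          * (K : ℂ) ^ ((α : ℂ) - ((R : ℂ) + v * Complex.I))
          * (Complex.Gamma ((α : ℂ) + 1) * Complex.Gamma ((R : ℂ) + v * Complex.I - (α : ℂ))
              / Complex.Gamma ((R : ℂ) + v * Complex.I + 1)) := by
  set σ : ℝ := R - α with hσdef
  have hσ : 0 < σ := sub_pos.2 hR
  have hα0 : 0 < α := by linarith
  have hx : 0 < K / s := div_pos hK hs
  set b : ℂ := (α : ℂ) + 1 with hb
  have hb2 : 2 < b.re := by simp [hb]; linarith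
  set F : ℝ → ℂ := fun t => ((max (1 - t) 0 ^ α : ℝ) : ℂ)
  have hmellin (w : ℂ) (hw : 0 < w.re) : mellin F w = betaIntegral w b :=
    (hasMellin_max_one_sub_rpow hα0 hw).2
  have hsC : (s : ℂ) ≠ 0 := ofReal_ne_zero.2 hs.ne'
  have hintegrand (v : ℝ) : (s : ℂ) ^ ((R : ℂ) + v * Complex.I)
      * (K : ℂ) ^ ((α : ℂ) - ((R : ℂ) + v * Complex.I))
      * (Complex.Gamma b * Complex.Gamma ((R : ℂ) + v * Complex.I - (α : ℂ))
          / Complex.Gamma ((R : ℂ) + v * Complex.I + 1)) =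
      (s : ℂ) ^ (α : ℂ) * (((K / s : ℝ) : ℂ) ^ (-((σ : ℂ) + v * I)) *
        betaIntegral (σ + v * I) b) := by
    have hw : (R : ℂ) + v * I - α = σ + v * I := by rw [hσdef]; push_cast; ring
    have hw' : (α : ℂ) - (R + v * I) = -(σ + v * I) := by rw [← hw]; ring
    have hsum : (R : ℂ) + v * I + 1 = σ + v * I + b := by rw [← hw, hb]; ring
    have hspow : (s : ℂ) ^ ((R : ℂ) + v * I) = s ^ (α : ℂ) * s ^ ((σ : ℂ) + v * I) := by
      rw [← cpow_add _ _ hsC, ← hw]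
      congr 1
      ring
    have hdiv : ((K / s : ℝ) : ℂ) ^ (-((σ : ℂ) + v * I)) =
        s ^ ((σ : ℂ) + v * I) * K ^ (-((σ : ℂ) + v * I)) := by
      rw [div_eq_mul_inv, mul_comm, ofReal_mul, mul_cpow_ofReal_nonneg (by positivity) hK.le,
        ofReal_inv, inv_cpow _ _ (by rw [arg_ofReal_of_nonneg hs.le]; exact Real.pi_pos.ne),
        cpow_neg, inv_inv]
    rw [betaIntegral_eq_Gamma_mul_div _ _ (by simpa using hσ) (by linarith), hw, hw', hsum,
      hspow, hdiv]
    ring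
  have hvert : VerticalIntegrable (fun w => betaIntegral w b) σ :=
    verticalIntegrable_betaIntegral hσ hb2
  simp_rw [hintegrand]
  refine ⟨Integrable.const_mul ?_ _, ?_⟩
  · refine hvert.bdd_mul (c := (K / s) ^ (-σ)) ?_ (Filter.Eventually.of_forall fun v => ?_)
    · refine Continuous.aestronglyMeasurable ?_
      exact Continuous.const_cpow (by fun_prop) (Or.inl (ofReal_ne_zero.2 hx.ne'))
    · rw [norm_cpow_eq_rpow_re_of_pos hx]
      simp
  · have hvertF : VerticalIntegrable (mellin F) σ := by
      refine hvert.congr (Filter.Eventually.of_forall fun v => ?_)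
      exact (hmellin _ (by simpa using hσ)).symm
    have hcont : ContinuousAt F (K / s) := by
      refine (continuous_ofReal.comp ?_).continuousAt
      exact Continuous.rpow_const (by fun_prop) fun _ => Or.inr hα0.le
    have hinv := mellinInv_mellin_eq σ F hx
      (hasMellin_max_one_sub_rpow hα0 (by simpa using hσ)).1 hvertF hcont
    have hpay : max (s - K) 0 ^ α = s ^ α * max (1 - K / s) 0 ^ α := by
      rw [← Real.mul_rpow hs.le (le_max_right _ _), mul_max_of_nonneg _ _ hs.le]
      congr 2
      · field_simp
      · simp
    rw [hpay, ofReal_mul, ofReal_cpow hs.le]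
    change (s : ℂ) ^ (α : ℂ) * F (K / s) = _
    rw [← hinv, mellinInv, integral_const_mul]
    have hcongr (v : ℝ) : mellin F (σ + v * I) = betaIntegral (σ + v * I) b :=
      hmellin _ (by simpa using hσ)
    simp_rw [hcongr, smul_eq_mul, real_smul]
    push_cast
    ring
end

section
/- Let K > 0, R > 0 and s > 0. Then the principal-value inversion of the digital payoff holds: lim_{c→∞} (1/2π) ∫_{−c}^{c} s^{R+iv} K^{−R−iv} / (R+iv) dv = f(s), where f(s) = 0 if s < K, f(s) = 1/2 if s = K, and f(s) = 1 if s > K. -/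
open MeasureTheory Complex Filter

/-- The integrals of a holomorphic function along the two vertical sides of a rectangle differ by
at most the integrals along its horizontal sides. -/
lemma norm_sub_vertical_integral_le {f : ℂ → ℂ} {p q c : ℝ}
    (hf : DifferentiableOn ℂ f (Set.uIcc p q ×ℂ Set.uIcc (-c) c)) :
    ‖(∫ v in (-c)..c, f (p + v * I)) - ∫ v in (-c)..c, f (q + v * I)‖
      ≤ ‖∫ x in p..q, f (x + (-c : ℝ) * I)‖ + ‖∫ x in p..q, f (x + c * I)‖ := by
  have h := integral_boundary_rect_eq_zero_of_differentiableOn f ⟨p, -c⟩ ⟨q, c⟩ hf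
  simp only [smul_eq_mul] at h
  have h' : I * ((∫ v in (-c)..c, f (p + v * I)) - ∫ v in (-c)..c, f (q + v * I))
      = (∫ x in p..q, f (x + (-c : ℝ) * I)) - ∫ x in p..q, f (x + c * I) := by
    linear_combination -h
  have hn := congrArg norm h'
  rw [norm_mul, norm_I, one_mul] at hn
  rw [hn]
  exact norm_sub_le _ _

lemma norm_cexp_mul_add_mul_I (a x y : ℝ) :
    ‖cexp (a * (x + y * I))‖ = Real.exp (a * x) := by
  simp [norm_exp]

lemma abs_im_le_norm_add_mul_I (x y : ℝ) : |y| ≤ ‖(x : ℂ) + y * I‖ := by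
  simpa using abs_im_le_norm ((x : ℂ) + y * I)

lemma abs_re_le_norm_add_mul_I (x y : ℝ) : |x| ≤ ‖(x : ℂ) + y * I‖ := by
  simpa using abs_re_le_norm ((x : ℂ) + y * I)

lemma add_mul_I_ne_zero {x : ℝ} (hx : x ≠ 0) (y : ℝ) : (x : ℂ) + y * I ≠ 0 := fun h =>
  hx (by simpa using congrArg re h)

/-- The exponential kernel `e^{az}/z` with `a < 0` decays horizontally to the right. -/
lemma norm_horizontal_integral_le {a R X y : ℝ} (ha : a < 0) (hRX : R ≤ X) (hy : y ≠ 0) :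
    ‖∫ x in R..X, cexp (a * (x + y * I)) / (x + y * I)‖ ≤ Real.exp (a * R) / (-a) / |y| := by
  have hy' : 0 < |y| := abs_pos.mpr hy
  have h : ‖∫ x in R..X, cexp (a * (x + y * I)) / (x + y * I)‖
      ≤ ∫ x in R..X, Real.exp (a * x) / |y| := by
    refine intervalIntegral.norm_integral_le_of_norm_le hRX (.of_forall fun x _ => ?_)
      (Continuous.intervalIntegrable (by fun_prop) _ _)
    rw [norm_div, norm_cexp_mul_add_mul_I]
    gcongr
    exact abs_im_le_norm_add_mul_I x y
  refine h.trans ?_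
  rw [intervalIntegral.integral_div]
  gcongr
  have : ∫ x in R..X, Real.exp (a * x) = (Real.exp (a * R) - Real.exp (a * X)) / (-a) := by
    simp only [intervalIntegral.integral_comp_mul_left _ ha.ne, integral_exp, smul_eq_mul]
    have := ha.ne
    field_simp
    ring
  rw [this]
  have := Real.exp_pos (a * X)
  have : 0 < -a := by linarith
  gcongr
  linarith

lemma tendsto_vertical_integral_of_neg {a R : ℝ} (ha : a < 0) (hR : 0 < R) :
    Tendsto (fun c : ℝ => ∫ v in (-c)..c, cexp (a * (R + v * I)) / (R + v * I))
      atTop (nhds 0) := by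
  have hlim : Tendsto (fun c : ℝ => Real.exp (a * R) / (-a) / c + Real.exp (a * R) / (-a) / c
      + 2 * Real.exp (a * (R + c))) atTop (nhds 0) := by
    have h1 : Tendsto (fun c : ℝ => Real.exp (a * R) / (-a) / c) atTop (nhds 0) :=
      tendsto_id.const_div_atTop _
    have h2 : Tendsto (fun c : ℝ => Real.exp (a * (R + c))) atTop (nhds 0) :=
      Real.tendsto_exp_atBot.comp
        ((tendsto_atTop_add_const_left _ R tendsto_id).const_mul_atTop_of_neg ha)
    simpa using (h1.add h1).add (h2.const_mul 2)
  refine squeeze_zero_norm' ?_ hlim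
  filter_upwards [eventually_gt_atTop 0] with c hc
  have hRX : R ≤ R + c := by linarith
  have hdiff : DifferentiableOn ℂ (fun z : ℂ => cexp (a * z) / z)
      (Set.uIcc R (R + c) ×ℂ Set.uIcc (-c) c) := by
    refine DifferentiableOn.div (by fun_prop) differentiableOn_id fun z hz h0 => ?_
    have hre := (mem_reProdIm.mp hz).1
    rw [Set.uIcc_of_le hRX, h0] at hre
    exact absurd hre.1 (by simpa using hR)
  have hrect := norm_sub_vertical_integral_le hdiff
  have hlow := norm_horizontal_integral_le ha hRX (neg_ne_zero.mpr hc.ne')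
  have hup := norm_horizontal_integral_le ha hRX hc.ne'
  rw [abs_neg] at hlow
  rw [abs_of_pos hc] at hlow hup
  have hright : ‖∫ v in (-c)..c,
      cexp (a * ((R + c : ℝ) + v * I)) / ((R + c : ℝ) + v * I)‖
      ≤ 2 * Real.exp (a * (R + c)) := by
    have h := intervalIntegral.norm_integral_le_of_norm_le_const (a := -c) (b := c)
      (f := fun v : ℝ => cexp (a * ((R + c : ℝ) + v * I)) / ((R + c : ℝ) + v * I))
      (C := Real.exp (a * (R + c)) / c) fun v _ => by
        rw [norm_div, norm_cexp_mul_add_mul_I]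
        gcongr
        refine le_trans ?_ (abs_re_le_norm_add_mul_I (R + c) v)
        exact le_trans (by linarith) (le_abs_self _)
    refine h.trans_eq ?_
    rw [abs_of_pos (by linarith)]
    field_simp
    ring
  have := norm_sub_norm_le (∫ v in (-c)..c, cexp (a * (R + v * I)) / (R + v * I))
    (∫ v in (-c)..c, cexp (a * ((R + c : ℝ) + v * I)) / ((R + c : ℝ) + v * I))
  linarith

lemma vertical_integral_inv {R : ℝ} (hR : R ≠ 0) (c : ℝ) :
    ∫ v in (-c)..c, ((R : ℂ) + v * I)⁻¹ = (2 * Real.arctan (c / R) : ℝ) := by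
  have hcont : Continuous fun v : ℝ => ((R : ℂ) + v * I)⁻¹ :=
    Continuous.inv₀ (by fun_prop) (add_mul_I_ne_zero hR)
  have hcont' : Continuous fun v : ℝ => ((R : ℂ) + (-v : ℝ) * I)⁻¹ := hcont.comp continuous_neg
  have hneg := intervalIntegral.integral_comp_neg (a := -c) (b := c)
    fun v : ℝ => ((R : ℂ) + v * I)⁻¹
  rw [neg_neg] at hneg
  have hsum : (∫ v in (-c)..c, ((R : ℂ) + v * I)⁻¹)
      + ∫ v in (-c)..c, ((R : ℂ) + (-v : ℝ) * I)⁻¹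
      = (2 * ∫ v in (-c)..c, R / (R ^ 2 + v ^ 2) : ℝ) := by
    rw [← intervalIntegral.integral_add (hcont.intervalIntegrable _ _)
      (hcont'.intervalIntegrable _ _),
      ← intervalIntegral.integral_const_mul, ← intervalIntegral.integral_ofReal]
    refine intervalIntegral.integral_congr fun v _ => ?_
    have h1 := add_mul_I_ne_zero hR v
    have h2 := add_mul_I_ne_zero hR (-v)
    have h3 : (R : ℂ) ^ 2 + v ^ 2 = (R + v * I) * (R + (-v : ℝ) * I) := by
      push_cast
      linear_combination v ^ 2 * I_sq
    push_cast at h2 h3 ⊢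
    rw [h3]
    rw [neg_mul, ← sub_eq_add_neg] at h2 ⊢
    field_simp
    ring
  rw [hneg, integral_div_sq_add_sq, neg_div, Real.arctan_neg] at hsum
  push_cast at hsum ⊢
  linear_combination hsum / 2

lemma tendsto_two_mul_arctan_div {R : ℝ} (hR : 0 < R) :
    Tendsto (fun c : ℝ => ((2 * Real.arctan (c / R) : ℝ) : ℂ)) atTop (nhds Real.pi) := by
  have h : Tendsto (fun c : ℝ => 2 * Real.arctan (c / R)) atTop (nhds Real.pi) := by
    have := ((Real.tendsto_arctan_atTop.mono_right nhdsWithin_le_nhds).comp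
      (tendsto_id.atTop_div_const hR)).const_mul 2
    rwa [mul_div_cancel₀ _ two_ne_zero] at this
  exact (continuous_ofReal.tendsto _).comp h

lemma differentiable_dslope_cexp_mul (a : ℂ) :
    Differentiable ℂ (dslope (fun z : ℂ => cexp (a * z)) 0) := by
  rw [← differentiableOn_univ, differentiableOn_dslope univ_mem]
  fun_prop

/-- The integrals of the entire function `(e^{az} - 1)/z` along `Re z = R` and `Re z = -R`
have the same principal value. -/
lemma tendsto_sub_vertical_integral_dslope (a R : ℝ) :
    Tendsto (fun c : ℝ => (∫ v in (-c)..c, dslope (fun z : ℂ => cexp (a * z)) 0 (R + v * I))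
      - ∫ v in (-c)..c, dslope (fun z : ℂ => cexp (a * z)) 0 ((-R : ℝ) + v * I))
      atTop (nhds 0) := by
  set g := dslope (fun z : ℂ => cexp (a * z)) 0 with hg
  have hdiff : Differentiable ℂ g := differentiable_dslope_cexp_mul a
  have hbound : ∀ y : ℝ, y ≠ 0 → ‖∫ x in R..(-R), g (x + y * I)‖
      ≤ (Real.exp (|a| * |R|) + 1) / |y| * |-R - R| := fun y hy => by
    have hy' : 0 < |y| := abs_pos.mpr hy
    refine intervalIntegral.norm_integral_le_of_norm_le_const fun x hx => ?_
    have hne : (x : ℂ) + y * I ≠ 0 := fun h => hy (by simpa using congrArg im h)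
    have hx' : |x| ≤ |R| := by
      have h := Set.uIoc_subset_uIcc hx
      rcases Set.mem_uIcc.mp h with h | h
      · exact abs_le.mpr ⟨by linarith [neg_abs_le R], by linarith [neg_le_abs R]⟩
      · exact abs_le.mpr ⟨by linarith [neg_abs_le R, le_abs_self R], by linarith [le_abs_self R]⟩
    rw [hg, dslope_of_ne _ hne, slope_def_field, norm_div, sub_zero]
    gcongr
    · refine (norm_sub_le _ _).trans ?_
      rw [norm_cexp_mul_add_mul_I]
      simp only [mul_zero, exp_zero, norm_one]
      refine add_le_add (Real.exp_le_exp.mpr ?_) le_rfl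
      calc a * x ≤ |a * x| := le_abs_self _
        _ = |a| * |x| := abs_mul _ _
        _ ≤ |a| * |R| := by gcongr
    · exact abs_im_le_norm_add_mul_I x y
  have hlim : Tendsto (fun c : ℝ => (Real.exp (|a| * |R|) + 1) / c * |-R - R|
      + (Real.exp (|a| * |R|) + 1) / c * |-R - R|) atTop (nhds 0) := by
    have h : Tendsto (fun c : ℝ => (Real.exp (|a| * |R|) + 1) / c) atTop (nhds 0) :=
      tendsto_id.const_div_atTop _
    simpa using (h.mul_const |-R - R|).add (h.mul_const |-R - R|)
  refine squeeze_zero_norm' ?_ hlim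
  filter_upwards [eventually_gt_atTop 0] with c hc
  have hlow := hbound (-c) (neg_ne_zero.mpr hc.ne')
  have hup := hbound c hc.ne'
  rw [abs_neg] at hlow
  rw [abs_of_pos hc] at hlow hup
  exact (norm_sub_vertical_integral_le hdiff.differentiableOn).trans (add_le_add hlow hup)

lemma vertical_integral_eq_dslope_add {R : ℝ} (hR : R ≠ 0) (a c : ℝ) :
    ∫ v in (-c)..c, cexp (a * (R + v * I)) / (R + v * I)
      = (∫ v in (-c)..c, dslope (fun z : ℂ => cexp (a * z)) 0 (R + v * I))
        + (2 * Real.arctan (c / R) : ℝ) := by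
  have hcont : Continuous fun v : ℝ => ((R : ℂ) + v * I)⁻¹ :=
    Continuous.inv₀ (by fun_prop) (add_mul_I_ne_zero hR)
  have hslope : Continuous fun v : ℝ => dslope (fun z : ℂ => cexp (a * z)) 0 (R + v * I) :=
    (differentiable_dslope_cexp_mul a).continuous.comp
      (g := dslope (fun z : ℂ => cexp (a * z)) 0) (by fun_prop)
  rw [← vertical_integral_inv hR, ← intervalIntegral.integral_add
    (hslope.intervalIntegrable _ _)
    (hcont.intervalIntegrable _ _)]
  refine intervalIntegral.integral_congr fun v _ => ?_
  have hne := add_mul_I_ne_zero hR v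
  simp only [dslope_of_ne _ hne, slope_def_field, mul_zero, exp_zero, sub_zero]
  field_simp
  ring

lemma vertical_integral_neg (a R c : ℝ) :
    ∫ v in (-c)..c, cexp (a * ((-R : ℝ) + v * I)) / ((-R : ℝ) + v * I)
      = -∫ v in (-c)..c, cexp ((-a : ℝ) * (R + v * I)) / (R + v * I) := by
  have h := intervalIntegral.integral_comp_neg (a := -c) (b := c)
    fun v : ℝ => cexp (a * ((-R : ℝ) + v * I)) / ((-R : ℝ) + v * I)
  rw [neg_neg] at h
  rw [← h, ← intervalIntegral.integral_neg]
  refine intervalIntegral.integral_congr fun v _ => ?_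
  have h1 : ((-R : ℝ) : ℂ) + (-v : ℝ) * I = -(R + v * I) := by push_cast; ring
  simp only [h1]
  rw [div_neg, ofReal_neg, mul_neg, neg_mul]

lemma tendsto_vertical_integral_of_pos {a R : ℝ} (ha : 0 < a) (hR : 0 < R) :
    Tendsto (fun c : ℝ => ∫ v in (-c)..c, cexp (a * (R + v * I)) / (R + v * I))
      atTop (nhds (2 * Real.pi)) := by
  have harctan := tendsto_two_mul_arctan_div hR
  have h := ((tendsto_sub_vertical_integral_dslope a R).add (harctan.add harctan)).sub
    (tendsto_vertical_integral_of_neg (neg_lt_zero.mpr ha) hR)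
  rw [zero_add, sub_zero, ← two_mul] at h
  refine h.congr fun c => ?_
  have h1 := vertical_integral_eq_dslope_add hR.ne' a c
  have h2 := vertical_integral_eq_dslope_add (neg_ne_zero.mpr hR.ne') a c
  rw [vertical_integral_neg, div_neg, Real.arctan_neg] at h2
  push_cast at h1 h2 ⊢
  linear_combination h2 - h1

lemma cpow_mul_cpow_neg_eq_cexp {s K : ℝ} (hs : 0 < s) (hK : 0 < K) (z : ℂ) :
    (s : ℂ) ^ z * (K : ℂ) ^ (-z) = cexp (Real.log (s / K) * z) := by
  rw [cpow_def_of_ne_zero (ofReal_ne_zero.mpr hs.ne'),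
    cpow_def_of_ne_zero (ofReal_ne_zero.mpr hK.ne'), ← exp_add, ← ofReal_log hs.le,
    ← ofReal_log hK.le, Real.log_div hs.ne' hK.ne']
  push_cast
  ring_nf

/-- principal-value inversion of the digital payoff:
`lim_{c→∞} (1/2π) ∫_{−c}^{c} s^{R+iv} K^{−R−iv}/(R+iv) dv` equals `0`, `1/2` or `1`
according as `s < K`, `s = K` or `s > K`. -/
theorem digital_inversion_principal_value (K s R : ℝ) (hK : 0 < K) (hs : 0 < s)
    (hR : 0 < R) :
    (s < K → Tendsto (fun c : ℝ => (1 / (2 * (Real.pi : ℂ)))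
        * ∫ v in (-c)..c, (s : ℂ) ^ ((R : ℂ) + v * Complex.I)
            * (K : ℂ) ^ (-((R : ℂ) + v * Complex.I)) / ((R : ℂ) + v * Complex.I))
      atTop (nhds (0 : ℂ)))
    ∧ (s = K → Tendsto (fun c : ℝ => (1 / (2 * (Real.pi : ℂ)))
        * ∫ v in (-c)..c, (s : ℂ) ^ ((R : ℂ) + v * Complex.I)
            * (K : ℂ) ^ (-((R : ℂ) + v * Complex.I)) / ((R : ℂ) + v * Complex.I))
      atTop (nhds (1 / 2 : ℂ)))
    ∧ (K < s → Tendsto (fun c : ℝ => (1 / (2 * (Real.pi : ℂ)))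
        * ∫ v in (-c)..c, (s : ℂ) ^ ((R : ℂ) + v * Complex.I)
            * (K : ℂ) ^ (-((R : ℂ) + v * Complex.I)) / ((R : ℂ) + v * Complex.I))
      atTop (nhds (1 : ℂ))) := by
  simp only [cpow_mul_cpow_neg_eq_cexp hs hK]
  have hpi : (Real.pi : ℂ) ≠ 0 := ofReal_ne_zero.mpr Real.pi_ne_zero
  refine ⟨fun h => ?_, fun h => ?_, fun h => ?_⟩
  · have ha : Real.log (s / K) < 0 := Real.log_neg (div_pos hs hK) ((div_lt_one hK).mpr h)
    simpa using (tendsto_vertical_integral_of_neg ha hR).const_mul (1 / (2 * (Real.pi : ℂ)))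
  · have hlim := (tendsto_two_mul_arctan_div hR).const_mul (1 / (2 * (Real.pi : ℂ)))
    simp only [← vertical_integral_inv hR.ne'] at hlim
    rw [show 1 / (2 * (Real.pi : ℂ)) * Real.pi = 1 / 2 by field_simp] at hlim
    simpa [h, div_self hK.ne'] using hlim
  · have ha : 0 < Real.log (s / K) := Real.log_pos ((one_lt_div hK).mpr h)
    have hlim := (tendsto_vertical_integral_of_pos ha hR).const_mul (1 / (2 * (Real.pi : ℂ)))
    rwa [one_div_mul_cancel (mul_ne_zero two_ne_zero hpi)] at hlim
end

section
/- Let s > 0, R > 0 and R' < 0. Then the functions v ↦ s^{R+iv}/(R+iv)² and v ↦ s^{R'+iv}/(R'+iv)² are Lebesgue integrable on ℝ and the log contract payoff satisfies log s = (1/2π) ∫_{−∞}^{∞} s^{R+iv}/(R+iv)² dv − (1/2π) ∫_{−∞}^{∞} s^{R'+iv}/(R'+iv)² dv. -/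
open MeasureTheory Complex

/-- The negative part of the logarithm has Mellin transform `z ↦ 1 / z ^ 2` for `0 < re z`. -/
theorem hasMellin_max_neg_log {z : ℂ} (hz : 0 < z.re) :
    HasMellin (fun t : ℝ => ((max (-Real.log t) 0 : ℝ) : ℂ)) z (1 / z ^ 2) := by
  let f : ℝ → ℂ := Set.indicator (Set.Ioc 0 1) fun _ => 1
  have hf_top : f =O[Filter.atTop] fun t : ℝ => t ^ (-(z.re + 1)) := by
    refine Asymptotics.IsBigO.congr' (Asymptotics.isBigO_zero _ _) ?_ Filter.EventuallyEq.rfl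
    filter_upwards [Filter.eventually_gt_atTop 1] with t ht
    simp [f, ht]
  have hf_zero : f =O[nhdsWithin 0 (Set.Ioi 0)] fun t : ℝ => t ^ (-(0 : ℝ)) := by
    refine Asymptotics.isBigO_of_le _ fun t => ?_
    by_cases ht : t ∈ Set.Ioc (0 : ℝ) 1 <;> simp [f, ht]
  have hf_int : LocallyIntegrableOn f (Set.Ioi 0) :=
    ((locallyIntegrable_const (1 : ℂ)).indicator measurableSet_Ioc).locallyIntegrableOn _
  obtain ⟨hconv, hderiv⟩ := mellin_hasDerivAt_of_isBigO_rpow hf_int hf_top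
    (by linarith : z.re < z.re + 1) hf_zero hz
  have hinv : HasDerivAt (mellin f) (-(z ^ 2)⁻¹) z := by
    refine (hasDerivAt_inv (by rintro rfl; simp at hz)).congr_of_eventuallyEq ?_
    filter_upwards [(isOpen_lt continuous_const continuous_re).mem_nhds hz] with w hw
    simpa using (hasMellin_one_Ioc hw).2
  have heq : Set.EqOn (fun t : ℝ => ((max (-Real.log t) 0 : ℝ) : ℂ))
      (fun t => (-1 : ℂ) • (Real.log t • f t)) (Set.Ioi 0) := by
    intro t ht
    have ht : 0 < t := ht
    rcases le_or_gt t 1 with h | h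
    · simp [f, ht, h, max_eq_left (neg_nonneg.2 (Real.log_nonpos ht.le h))]
    · simp [f, h, (Real.log_pos h).le]
  have hmellin := hderiv.unique hinv
  constructor
  · refine (hconv.const_smul (-1 : ℂ)).congr_fun (fun t ht => ?_) measurableSet_Ioi
    simp only [heq ht]
  · have : mellin (fun t : ℝ => ((max (-Real.log t) 0 : ℝ) : ℂ)) z
        = mellin (fun t => (-1 : ℂ) • (Real.log t • f t)) z := by
      refine setIntegral_congr_fun measurableSet_Ioi fun t ht => ?_
      simp only [heq ht]
    rw [this, mellin_const_smul, hmellin]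
    simp

theorem integrable_one_div_add_mul_I_sq {R : ℝ} (hR : R ≠ 0) :
    Integrable fun v : ℝ => 1 / ((R : ℂ) + v * I) ^ 2 := by
  refine ((integrable_inv_one_add_sq.comp_div hR).const_mul (R ^ 2)⁻¹).mono'
    (by measurability) (.of_forall fun v => le_of_eq ?_)
  rw [norm_div, norm_pow, norm_one, ← normSq_eq_norm_sq, normSq_add_mul_I, one_div, ← mul_inv]
  congr 1
  field_simp

theorem integrable_cpow_div_sq {s R : ℝ} (hs : 0 < s) (hR : R ≠ 0) :
    Integrable fun v : ℝ => (s : ℂ) ^ ((R : ℂ) + v * I) / ((R : ℂ) + v * I) ^ 2 := by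
  have hs' : (s : ℂ) ≠ 0 := ofReal_ne_zero.2 hs.ne'
  have hint := integrable_one_div_add_mul_I_sq hR
  simp only [one_div] at hint
  simp only [div_eq_mul_inv]
  refine hint.bdd_mul (c := s ^ R) ?_ (.of_forall fun v => ?_)
  · exact (Continuous.const_cpow (by fun_prop) (.inl hs')).aestronglyMeasurable
  · simp [norm_cpow_eq_rpow_re_of_pos hs]

/-- The positive part of the logarithm as an inverse Mellin transform. -/
theorem integral_cpow_div_sq_of_pos {s R : ℝ} (hs : 0 < s) (hR : 0 < R) :
    (1 / (2 * (Real.pi : ℂ))) *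
      ∫ v : ℝ, (s : ℂ) ^ ((R : ℂ) + v * I) / ((R : ℂ) + v * I) ^ 2
      = ((max (Real.log s) 0 : ℝ) : ℂ) := by
  have hre (v : ℝ) : 0 < ((R : ℂ) + v * I).re := by simpa using hR
  have hM (v : ℝ) := (hasMellin_max_neg_log (hre v)).2
  have hinv := mellinInv_mellin_eq R (fun t : ℝ => ((max (-Real.log t) 0 : ℝ) : ℂ))
    (inv_pos.2 hs) (hasMellin_max_neg_log (by simpa using hR)).1
    (by simpa only [VerticalIntegrable, hM] using integrable_one_div_add_mul_I_sq hR.ne')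
    (by
      have := Real.continuousAt_log (inv_pos.2 hs).ne'
      fun_prop)
  rw [Real.log_inv, neg_neg] at hinv
  rw [← hinv, mellinInv, real_smul]
  push_cast
  congr 1
  refine integral_congr_ae (.of_forall fun v => ?_)
  simp only [hM]
  rw [inv_cpow_ofReal_nonneg hs.le, cpow_neg, inv_inv, smul_eq_mul, mul_one_div]

/-- The negative part of the logarithm as an inverse Mellin transform. -/
theorem integral_cpow_div_sq_of_neg {s R : ℝ} (hs : 0 < s) (hR : R < 0) :
    (1 / (2 * (Real.pi : ℂ))) *
      ∫ v : ℝ, (s : ℂ) ^ ((R : ℂ) + v * I) / ((R : ℂ) + v * I) ^ 2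
      = ((max (-Real.log s) 0 : ℝ) : ℂ) := by
  rw [← Real.log_inv, ← integral_cpow_div_sq_of_pos (inv_pos.2 hs) (neg_pos.2 hR),
    ← integral_neg_eq_self]
  congr 1
  refine integral_congr_ae (.of_forall fun v => ?_)
  have hneg : ((-R : ℝ) : ℂ) + v * I = -((R : ℂ) + (-v : ℝ) * I) := by
    push_cast
    ring
  simp only [hneg]
  rw [ofReal_inv, inv_cpow_ofReal_nonneg hs.le, cpow_neg, inv_inv, neg_sq]

/-- inversion formula for the log contract:
`log s = (1/2π) ∫ s^{R+iv}/(R+iv)² dv − (1/2π) ∫ s^{R'+iv}/(R'+iv)² dv`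
for `R > 0 > R'`. -/
theorem log_contract_inversion (s R R' : ℝ) (hs : 0 < s) (hR : 0 < R) (hR' : R' < 0) :
    Integrable (fun v : ℝ => (s : ℂ) ^ ((R : ℂ) + v * Complex.I)
      / ((R : ℂ) + v * Complex.I) ^ 2) ∧
    Integrable (fun v : ℝ => (s : ℂ) ^ ((R' : ℂ) + v * Complex.I)
      / ((R' : ℂ) + v * Complex.I) ^ 2) ∧
    (↑(Real.log s) : ℂ)
      = (1 / (2 * (Real.pi : ℂ)))
          * (∫ v : ℝ, (s : ℂ) ^ ((R : ℂ) + v * Complex.I) / ((R : ℂ) + v * Complex.I) ^ 2)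
        - (1 / (2 * (Real.pi : ℂ)))
          * ∫ v : ℝ, (s : ℂ) ^ ((R' : ℂ) + v * Complex.I) / ((R' : ℂ) + v * Complex.I) ^ 2 := by
  refine ⟨integrable_cpow_div_sq hs hR.ne', integrable_cpow_div_sq hs hR'.ne, ?_⟩
  rw [integral_cpow_div_sq_of_pos hs hR, integral_cpow_div_sq_of_neg hs hR', ← ofReal_sub,
    max_zero_sub_max_neg_zero_eq_self]
end

section
/- Let μ ∈ ℝ, σ > 0, x ∈ ℝ and R > 0. Then the function v ↦ e^{(x−μ)(R+iv) + (σ²/2)(R+iv)²} / (R+iv) is Lebesgue integrable on ℝ and Φ((x−μ)/σ) = (1/2π) ∫_{−∞}^{∞} e^{(x−μ)(R+iv) + (σ²/2)(R+iv)²} / (R+iv) dv, where Φ denotes the cumulative distribution function of the standard normal distribution N(0,1). -/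
open MeasureTheory Complex

/-- The exponential integral `∫_{t < u} σ e^{σ t z} dt = e^{σ u z} / z`, weighted by the Gaussian
transform factor `e^{σ² z² / 2}`. -/
lemma integral_Iio_gaussianKernel {σ u : ℝ} {z : ℂ} (hσ : 0 < σ) (hz : 0 < z.re) :
    ∫ t in Set.Iio u, (σ : ℂ) * exp (σ * t * z + σ ^ 2 / 2 * z ^ 2)
      = exp (σ * u * z + σ ^ 2 / 2 * z ^ 2) / z := by
  have hz0 : z ≠ 0 := fun h => by simp [h] at hz
  have hσ0 : (σ : ℂ) ≠ 0 := by exact_mod_cast hσ.ne'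
  have hre : 0 < (σ * z).re := by simpa using mul_pos hσ hz
  have h : ∀ t : ℝ, (σ : ℂ) * exp (σ * t * z + σ ^ 2 / 2 * z ^ 2)
      = (σ * exp (σ ^ 2 / 2 * z ^ 2)) * exp (σ * z * t) := fun t => by
    rw [exp_add, mul_right_comm (σ : ℂ) t z]; ring
  simp_rw [h]
  rw [integral_const_mul, ← integral_Iic_eq_integral_Iio, integral_exp_mul_complex_Iic hre, exp_add,
    mul_right_comm (σ : ℂ) u z]
  field_simp

/-- Integrating the kernel along the vertical line `Re z = R` gives a Gaussian density. -/
lemma integral_vertical_gaussianKernel {σ : ℝ} (hσ : 0 < σ) (R t : ℝ) :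
    ∫ v : ℝ, (σ : ℂ) * exp (σ * t * (R + v * I) + σ ^ 2 / 2 * (R + v * I) ^ 2)
      = ((2 * Real.pi * ((√(2 * Real.pi))⁻¹ * Real.exp (-t ^ 2 / 2)) : ℝ) : ℂ) := by
  have hσ0 : (σ : ℂ) ≠ 0 := by exact_mod_cast hσ.ne'
  have h : ∀ v : ℝ, σ * t * (R + v * I) + σ ^ 2 / 2 * (R + v * I) ^ 2
      = (-((σ : ℂ) ^ 2 / 2)) * v ^ 2 + (σ * (t + σ * R) * I) * v
        + (σ * t * R + σ ^ 2 / 2 * R ^ 2) := fun v => by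
    linear_combination (σ ^ 2 / 2 * v ^ 2 : ℂ) * I_sq
  have hb : (-((σ : ℂ) ^ 2 / 2)).re < 0 := by
    have : (-((σ : ℂ) ^ 2 / 2)) = ((-(σ ^ 2 / 2) : ℝ) : ℂ) := by push_cast; ring
    rw [this, ofReal_re]
    have := pow_pos hσ 2
    linarith
  have hexp : (σ * t * R + σ ^ 2 / 2 * R ^ 2 : ℂ)
      - (σ * (t + σ * R) * I) ^ 2 / (4 * -((σ : ℂ) ^ 2 / 2)) = ((-t ^ 2 / 2 : ℝ) : ℂ) := by
    rw [mul_pow, I_sq]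
    push_cast
    field_simp
    ring
  have hroot : (Real.pi / - -((σ : ℂ) ^ 2 / 2)) ^ (1 / 2 : ℂ)
      = ((√(2 * Real.pi) / σ : ℝ) : ℂ) := by
    have h1 : (Real.pi / - -((σ : ℂ) ^ 2 / 2)) = ((2 * Real.pi / σ ^ 2 : ℝ) : ℂ) := by
      push_cast; field_simp
    have h2 : (1 / 2 : ℂ) = ((1 / 2 : ℝ) : ℂ) := by push_cast; rfl
    rw [h1, h2, ← ofReal_cpow (by positivity), ← Real.sqrt_eq_rpow,
      Real.sqrt_div (by positivity), Real.sqrt_sq hσ.le]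
  simp_rw [h]
  rw [integral_const_mul, integral_cexp_quadratic hb, hexp, hroot, ← ofReal_exp, ← ofReal_mul,
    ← ofReal_mul]
  congr 1
  have hs : √(2 * Real.pi) ≠ 0 := by positivity
  field_simp
  rw [Real.sq_sqrt (by positivity)]

/-- The kernel is jointly integrable over the vertical line and the half-line `t < u`. -/
lemma integrable_gaussianKernel {σ R : ℝ} (hσ : 0 < σ) (hR : 0 < R) (u : ℝ) :
    Integrable (fun p : ℝ × ℝ =>
      (σ : ℂ) * exp (σ * p.2 * (R + p.1 * I) + σ ^ 2 / 2 * (R + p.1 * I) ^ 2))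
      (volume.prod (volume.restrict (Set.Iio u))) := by
  have hv : Integrable (fun v : ℝ => Real.exp (-(σ ^ 2 / 2) * v ^ 2)) :=
    integrable_exp_neg_mul_sq (by positivity)
  have ht : Integrable (fun t : ℝ => Real.exp (σ * R * t)) (volume.restrict (Set.Iio u)) :=
    (integrableOn_exp_mul_Iic (mul_pos hσ hR) u).mono_set Set.Iio_subset_Iic_self
  refine ((hv.mul_prod ht).const_mul (σ * Real.exp (σ ^ 2 / 2 * R ^ 2))).mono'
    (by fun_prop) (.of_forall fun p => le_of_eq ?_)
  have hre : (σ * p.2 * (R + p.1 * I) + σ ^ 2 / 2 * (R + p.1 * I) ^ 2 : ℂ).re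
      = σ ^ 2 / 2 * R ^ 2 + (-(σ ^ 2 / 2) * p.1 ^ 2 + σ * R * p.2) := by
    have : (σ * p.2 * (R + p.1 * I) + σ ^ 2 / 2 * (R + p.1 * I) ^ 2 : ℂ)
        = ((σ ^ 2 / 2 * R ^ 2 + (-(σ ^ 2 / 2) * p.1 ^ 2 + σ * R * p.2) : ℝ) : ℂ)
          + ((σ * p.2 * p.1 + σ ^ 2 * R * p.1 : ℝ) : ℂ) * I := by
      push_cast
      linear_combination (σ ^ 2 / 2 * p.1 ^ 2 : ℂ) * I_sq
    rw [this, add_re, re_ofReal_mul, ofReal_re, I_re, mul_zero, add_zero]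
  rw [norm_mul, norm_exp, hre, Real.exp_add, Real.exp_add, norm_real, Real.norm_of_nonneg hσ.le]
  ring

/-- inversion formula for the Gaussian cumulative distribution function:
`Φ((x−μ)/σ) = (1/2π) ∫ e^{(x−μ)(R+iv) + (σ²/2)(R+iv)²}/(R+iv) dv` for `R > 0`. -/
theorem gaussian_cdf_inversion (μ σ x R : ℝ) (hσ : 0 < σ) (hR : 0 < R) :
    Integrable (fun v : ℝ =>
      Complex.exp (((x : ℂ) - (μ : ℂ)) * ((R : ℂ) + v * Complex.I)
          + ((σ : ℂ) ^ 2 / 2) * ((R : ℂ) + v * Complex.I) ^ 2)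
        / ((R : ℂ) + v * Complex.I)) ∧
    (↑(∫ t in Set.Iio ((x - μ) / σ), (Real.sqrt (2 * Real.pi))⁻¹ * Real.exp (-t ^ 2 / 2)) : ℂ)
      = (1 / (2 * (Real.pi : ℂ)))
        * ∫ v : ℝ, Complex.exp (((x : ℂ) - (μ : ℂ)) * ((R : ℂ) + v * Complex.I)
              + ((σ : ℂ) ^ 2 / 2) * ((R : ℂ) + v * Complex.I) ^ 2)
            / ((R : ℂ) + v * Complex.I) := by
  set u := (x - μ) / σ with hu
  have hx : (x : ℂ) - μ = σ * u := by
    have : x - μ = σ * u := by rw [hu]; field_simp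
    exact_mod_cast this
  have hkernel (v : ℝ) : exp (((x : ℂ) - μ) * (R + v * I) + (σ : ℂ) ^ 2 / 2 * (R + v * I) ^ 2)
        / (R + v * I)
      = ∫ t in Set.Iio u, (σ : ℂ) * exp (σ * t * (R + v * I) + σ ^ 2 / 2 * (R + v * I) ^ 2) := by
    rw [hx, integral_Iio_gaussianKernel hσ (by simpa using hR)]
  have hint := integrable_gaussianKernel hσ hR u
  simp_rw [hkernel]
  refine ⟨hint.integral_prod_left, ?_⟩
  rw [integral_integral_swap hint]
  simp_rw [integral_vertical_gaussianKernel hσ]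
  have hpi : (2 * Real.pi : ℂ) ≠ 0 := by exact_mod_cast Real.two_pi_pos.ne'
  rw [integral_complex_ofReal, integral_const_mul (2 * Real.pi), ofReal_mul, ofReal_mul, ofReal_ofNat,
    ← mul_assoc, one_div_mul_cancel hpi, one_mul]
end
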